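/- arXiv:1710.10422 — 8 statements merged into one kernel-verified Lean document; each statement's English description precedes it below -/
import Mathlib

section
/- Let X be a real Banach space that admits a direct sum decomposition X = Y ⊕ V, where Y and V are closed subspaces with Y finite dimensional. Let φ : X → ℝ be a C¹ functional that satisfies the Cerami condition, is bounded below, and satisfies φ(0) = 0 and inf_X φ < 0. Assume there exists ρ > 0 such that φ(y) ≤ 0 for all y ∈ Y with ‖y‖ ≤ ρ and φ(v) ≥ 0 for all v ∈ V with ‖v‖ ≤ ρ. Then φ has at least two critical points u₁ ≠ u₂ with u₁ ≠ 0 and u₂ ≠ 0 (that is, φ'(u₁) = 0 and φ'(u₂) = 0). -/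
section

open Set Filter Topology Metric MeasureTheory

/-- Lagrange interpolation of the polynomial `t ↦ det (1 + t B)`. -/
theorem ContinuousLinearMap.exists_det_one_add_eq_sum {E : Type*} [NormedAddCommGroup E]
    [NormedSpace ℝ E] [FiniteDimensional ℝ E] (v : ℕ → ℝ) (hv : Function.Injective v) :
    ∃ (s : Finset ℕ) (c : ℕ → ℝ), ∑ i ∈ s, c i = 1 ∧ ∀ B : E →L[ℝ] E,
      (1 + B).det = ∑ i ∈ s, c i * (1 + v i • B).det := by
  classical
  set n := Module.finrank ℝ E
  set s := Finset.range (n + 1)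
  refine ⟨s, fun i => (Lagrange.basis s v i).eval 1, ?_, fun B => ?_⟩
  · rw [← Polynomial.eval_finsetSum, Lagrange.sum_basis hv.injOn ⟨0, by simp [s]⟩]
    simp
  · let b := Module.finBasis ℝ E
    let A := LinearMap.toMatrix b b (B : E →ₗ[ℝ] E)
    let P : Polynomial ℝ := ((Polynomial.X : Polynomial ℝ) • A.map Polynomial.C +
      (1 : Matrix (Fin n) (Fin n) ℝ).map Polynomial.C).det
    have hP : ∀ t : ℝ, P.eval t = (1 + t • B).det := by
      intro t
      have h1 : (1 + t • B).det = (1 + t • A).det := by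
        rw [ContinuousLinearMap.det, ← LinearMap.det_toMatrix b]
        congr 1
        ext i j
        simp [A, LinearMap.toMatrix_apply, Matrix.one_apply, Finsupp.single_apply, eq_comm]
      rw [h1, ← Polynomial.coe_evalRingHom, RingHom.map_det]
      congr 1
      ext i j
      by_cases hij : i = j <;> simp [hij]
      all_goals ring
    have hdeg : P.degree < s.card := by
      refine lt_of_le_of_lt Polynomial.degree_le_natDegree ?_
      have := Polynomial.natDegree_det_X_add_C_le A (1 : Matrix (Fin n) (Fin n) ℝ)
      rw [Fintype.card_fin] at this
      simp only [s, Finset.card_range]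
      exact_mod_cast Nat.lt_succ_of_le this
    have h := congrArg (Polynomial.eval 1) (Lagrange.eq_interpolate (v := v) hv.injOn hdeg)
    rw [hP, one_smul, Lagrange.interpolate_apply, Polynomial.eval_finsetSum] at h
    rw [h]
    refine Finset.sum_congr rfl fun i _ => ?_
    simp [hP, mul_comm]

theorem bijOn_closedBall_of_lipschitz {E : Type*} [NormedAddCommGroup E] [NormedSpace ℝ E]
    [CompleteSpace E] [Nontrivial E] {r : ℝ} (hr : 0 ≤ r) {h : E → E} {L : NNReal} (hL : L < 1)
    (hlip : LipschitzOnWith L h (closedBall 0 r)) (hzero : ∀ x, ‖x‖ = r → h x = 0) :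
    BijOn (fun x => x + h x) (closedBall 0 r) (closedBall 0 r) := by
  classical
  set k : E → E := fun x => if ‖x‖ ≤ r then h x else 0
  have hlip' : ∀ x y, ‖x‖ ≤ r → ‖y‖ ≤ r → ‖h x - h y‖ ≤ L * ‖x - y‖ := by
    intro x y hx hy
    have := hlip.dist_le_mul x (by simpa using hx) y (by simpa using hy)
    simpa [dist_eq_norm] using this
  have hbd : ∀ x, ‖x‖ ≤ r → ‖h x‖ ≤ L * (r - ‖x‖) := by
    intro x hx
    obtain ⟨q, hq, hxq⟩ : ∃ q : E, ‖q‖ = r ∧ ‖x - q‖ = r - ‖x‖ := by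
      by_cases h0 : x = 0
      · obtain ⟨q, hq⟩ := exists_norm_eq E hr
        exact ⟨q, hq, by simp [h0, hq]⟩
      · have hx0 : 0 < ‖x‖ := norm_pos_iff.2 h0
        refine ⟨(r / ‖x‖) • x, ?_, ?_⟩
        · rw [norm_smul, Real.norm_of_nonneg (by positivity)]; field_simp
        · have : x - (r / ‖x‖) • x = ((‖x‖ - r) / ‖x‖) • x := by
            rw [sub_div, div_self hx0.ne', sub_smul, one_smul]
          rw [this, norm_smul, norm_div, norm_norm, Real.norm_of_nonpos (by linarith)]
          field_simp; ring
    have := hlip' x q hx hq.le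
    rwa [hzero q hq, sub_zero, hxq] at this
  have hk : LipschitzWith L k := by
    refine LipschitzWith.of_dist_le_mul fun x y => ?_
    rw [dist_eq_norm, dist_eq_norm]
    by_cases hx : ‖x‖ ≤ r <;> by_cases hy : ‖y‖ ≤ r
    · simpa [k, hx, hy] using hlip' x y hx hy
    · simp only [k, hx, hy, if_true, if_false, sub_zero]
      refine (hbd x hx).trans (mul_le_mul_of_nonneg_left ?_ L.2)
      have := norm_sub_norm_le y x
      rw [norm_sub_rev] at this
      linarith [not_le.1 hy]
    · simp only [k, hx, hy, if_true, if_false, zero_sub, norm_neg]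
      refine (hbd y hy).trans (mul_le_mul_of_nonneg_left ?_ L.2)
      have := norm_sub_norm_le x y
      linarith [not_le.1 hx]
    · simp only [k, hx, hy, if_false, sub_zero, norm_zero]
      positivity
  have hinj : Function.Injective fun x => x + k x := by
    intro x y hxy
    have h1 : x - y = k y - k x := by
      have : x + k x = y + k y := hxy
      rw [sub_eq_sub_iff_add_eq_add, this, add_comm]
    have h2 := hk.dist_le_mul y x
    rw [dist_eq_norm, dist_eq_norm, ← h1, norm_sub_rev y x] at h2
    have hL' : (L : ℝ) < 1 := hL
    have : ‖x - y‖ = 0 := by nlinarith [norm_nonneg (x - y)]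
    exact sub_eq_zero.1 (norm_eq_zero.1 this)
  have hsurj : ∀ y, ∃ x, x + k x = y := by
    intro y
    have hc : ContractingWith L fun x => y - k x := by
      refine ⟨hL, LipschitzWith.of_dist_le_mul fun a b => ?_⟩
      rw [dist_sub_left]
      exact hk.dist_le_mul a b
    refine ⟨ContractingWith.fixedPoint _ hc, ?_⟩
    have := hc.fixedPoint_isFixedPt
    have h1 : y - k (ContractingWith.fixedPoint _ hc) = ContractingWith.fixedPoint _ hc := this
    exact (sub_eq_iff_eq_add.1 h1).symm
  have hout : ∀ x, ¬ ‖x‖ ≤ r → x + k x = x := fun x hx => by simp [k, hx]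
  have heq : EqOn (fun x => x + k x) (fun x => x + h x) (closedBall 0 r) := by
    intro x hx
    have : ‖x‖ ≤ r := by simpa using hx
    simp [k, this]
  refine BijOn.congr ⟨fun x hx => ?_, hinj.injOn, fun y hy => ?_⟩ heq
  · by_contra hc
    rw [mem_closedBall_zero_iff] at hx hc
    have := hinj (hout _ hc)
    simp only at this
    rw [this] at hc
    exact hc hx
  · obtain ⟨x, hx⟩ := hsurj y
    refine ⟨x, ?_, hx⟩
    by_contra hc
    rw [mem_closedBall_zero_iff] at hy hc
    rw [hout x hc] at hx
    exact hc (hx ▸ hy)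

/-- There is no `C¹` retraction onto a sphere. -/
theorem not_exists_contDiff_retraction {E : Type*} [NormedAddCommGroup E] [InnerProductSpace ℝ E]
    [FiniteDimensional ℝ E] [Nontrivial E] {r : ℝ} (hr : 0 < r) {g : E → E} (hg : ContDiff ℝ 1 g)
    (hnorm : ∀ x, ‖g x‖ = r) (hid : ∀ x, ‖x‖ = r → g x = x) : False := by
  borelize E
  let μ : Measure E := Measure.addHaar
  set h : E → E := fun x => g x - x
  have hh : ContDiff ℝ 1 h := hg.sub contDiff_id
  have hcont : Continuous (fderiv ℝ h) := hh.continuous_fderiv one_ne_zero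
  have hdiff : ∀ x, HasFDerivAt h (fderiv ℝ h x) x := fun x =>
    ((hh.differentiable one_ne_zero) x).hasFDerivAt
  obtain ⟨M, hM⟩ := (isCompact_closedBall (0 : E) r).exists_bound_of_continuousOn hcont.continuousOn
  have hM0 : 0 ≤ M := (norm_nonneg _).trans (hM 0 (by simp [hr.le]))
  obtain ⟨δ, hδ, hdet⟩ : ∃ δ > 0, ∀ T : E →L[ℝ] E, ‖T‖ < δ → 0 < (1 + T).det := by
    have hc : Continuous fun T : E →L[ℝ] E => (1 + T).det :=
      ContinuousLinearMap.continuous_det.comp (continuous_const.add continuous_id)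
    have h1 : (0 : ℝ) < (1 + (0 : E →L[ℝ] E)).det := by
      rw [add_zero, ContinuousLinearMap.det]
      simp
    obtain ⟨δ, hδ, hb⟩ := Metric.eventually_nhds_iff.1 (hc.continuousAt.eventually (lt_mem_nhds h1))
    exact ⟨δ, hδ, fun T hT => hb (by simpa [dist_eq_norm] using hT)⟩
  have hlipM : LipschitzOnWith (NNReal.mk M hM0) h (closedBall 0 r) :=
    (convex_closedBall 0 r).lipschitzOnWith_of_nnnorm_fderiv_le
      (fun x _ => (hdiff x).differentiableAt) fun x hx => hM x hx
  have hderiv : ∀ (t : ℝ) (x : E), HasFDerivAt (fun x => x + t • h x) (1 + t • fderiv ℝ h x) x :=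
    fun t x => (hasFDerivAt_id x).add ((hdiff x).const_smul t)
  have hsmall : ∀ t : ℝ, 0 < t → t * (M + 1) < 1 → t * (M + 1) < δ →
      ∫ x in closedBall 0 r, (1 + t • fderiv ℝ h x).det ∂μ = μ.real (closedBall 0 r) := by
    intro t ht ht1 htδ
    have hbij := bijOn_closedBall_of_lipschitz (h := fun x => t • h x)
      (L := NNReal.mk (t * M) (by positivity)) hr.le (by
        rw [← NNReal.coe_lt_coe, NNReal.coe_mk, NNReal.coe_one]
        nlinarith) (by
        refine LipschitzOnWith.of_dist_le_mul fun x hx y hy => ?_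
        rw [dist_smul₀, Real.norm_of_nonneg ht.le]
        have := hlipM.dist_le_mul x hx y hy
        change _ ≤ t * M * _
        change _ ≤ M * _ at this
        rw [mul_assoc]
        gcongr) (fun x hx => by simp [h, hid x hx])
    have hint := integral_image_eq_integral_abs_det_fderiv_smul μ
      (isClosed_closedBall (x := (0 : E)) (ε := r)).measurableSet
      (fun x _ => (hderiv t x).hasFDerivWithinAt) hbij.injOn (fun _ => (1 : ℝ))
    rw [hbij.image_eq] at hint
    simp only [smul_eq_mul, mul_one, integral_const, measureReal_restrict_apply_univ] at hint
    rw [hint]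
    refine setIntegral_congr_fun isClosed_closedBall.measurableSet fun x hx => ?_
    refine (abs_of_pos (hdet _ ?_)).symm
    rw [norm_smul, Real.norm_of_nonneg ht.le]
    refine lt_of_le_of_lt ?_ htδ
    have := hM x hx
    gcongr
    linarith
  obtain ⟨τ, hτ, hτ1, hτδ⟩ : ∃ τ : ℝ, 0 < τ ∧ τ * (M + 1) < 1 ∧ τ * (M + 1) < δ := by
    refine ⟨min 1 δ / 2 / (M + 1), by positivity, ?_, ?_⟩ <;>
    · rw [div_mul_cancel₀ _ (by positivity)]
      have h1 := min_le_left 1 δ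
      have h2 := min_le_right 1 δ
      have h3 : 0 < min 1 δ := by positivity
      linarith
  let v : ℕ → ℝ := fun i => τ / (i + 1)
  have hv : Function.Injective v := by
    intro i j hij
    have hi : (0 : ℝ) < i + 1 := by positivity
    have hj : (0 : ℝ) < j + 1 := by positivity
    have : τ / (i + 1) = τ / ((j : ℝ) + 1) := hij
    field_simp at this
    have := add_right_cancel this
    exact_mod_cast this.symm
  obtain ⟨s, c, hc1, hc⟩ := ContinuousLinearMap.exists_det_one_add_eq_sum (E := E) v hv
  have hvi : ∀ i, ∫ x in closedBall 0 r, (1 + v i • fderiv ℝ h x).det ∂μ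
      = μ.real (closedBall 0 r) := by
    intro i
    have hi : (1 : ℝ) ≤ i + 1 := by simp
    have hle : v i ≤ τ := div_le_self hτ.le hi
    have hle' : v i * (M + 1) ≤ τ * (M + 1) := by gcongr
    exact hsmall _ (by positivity) (hle'.trans_lt hτ1) (hle'.trans_lt hτδ)
  have hzero : ∀ x, (1 + fderiv ℝ h x).det = 0 := by
    intro x
    have hgd : HasFDerivAt g (1 + fderiv ℝ h x) x := by
      have := hderiv 1 x
      simpa [h] using this
    have horth : ∀ w, inner ℝ (g x) ((1 + fderiv ℝ h x) w) = 0 := by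
      intro w
      have h1 := hgd.norm_sq
      have h2 : HasFDerivAt (fun x => ‖g x‖ ^ 2) (0 : E →L[ℝ] ℝ) x := by
        simp only [hnorm]
        exact hasFDerivAt_const _ _
      have h3 := congrArg (fun T : E →L[ℝ] ℝ => T w) (h1.unique h2)
      rw [two_smul] at h3
      have h4 : inner ℝ (g x) ((1 + fderiv ℝ h x) w) + inner ℝ (g x) ((1 + fderiv ℝ h x) w) = 0 :=
        h3
      linarith
    by_contra hne
    obtain ⟨w, hw⟩ := (LinearMap.equivOfDetNeZero
      ((1 + fderiv ℝ h x : E →L[ℝ] E) : E →ₗ[ℝ] E) hne).surjective (g x)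
    have := horth w
    have hw' : (1 + fderiv ℝ h x) w = g x := hw
    rw [hw', real_inner_self_eq_norm_sq, hnorm] at this
    exact (pow_pos hr 2).ne' this
  have hcontdet : ∀ t : ℝ, IntegrableOn (fun x => (1 + t • fderiv ℝ h x).det) (closedBall 0 r) μ :=
    fun t => ContinuousOn.integrableOn_compact (isCompact_closedBall 0 r)
      (ContinuousLinearMap.continuous_det.comp
        (continuous_const.add (hcont.const_smul t))).continuousOn
  have hfin : (0 : ℝ) = μ.real (closedBall 0 r) := by
    calc (0 : ℝ) = ∫ x in closedBall 0 r, (1 + fderiv ℝ h x).det ∂μ := by simp [hzero]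
      _ = ∑ i ∈ s, c i * ∫ x in closedBall 0 r, (1 + v i • fderiv ℝ h x).det ∂μ := by
          rw [integral_congr_ae (ae_of_all _ fun x => hc (fderiv ℝ h x)),
            integral_finsetSum _ fun i _ => (hcontdet (v i)).const_mul (c i)]
          simp_rw [integral_const_mul]
      _ = μ.real (closedBall 0 r) := by
          simp_rw [hvi]
          rw [← Finset.sum_mul, hc1, one_mul]
  have hpos : 0 < μ.real (closedBall 0 r) :=
    ENNReal.toReal_pos (measure_closedBall_pos μ 0 hr).ne' measure_closedBall_lt_top.ne
  linarith

/-- A continuous self-map of a nontrivial finite dimensional space that is the identity outside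
a bounded set has a zero. -/
theorem exists_eq_zero_of_eq_id_outside {W : Type*} [NormedAddCommGroup W] [NormedSpace ℝ W]
    [FiniteDimensional ℝ W] [Nontrivial W] {F : W → W} (hF : Continuous F) {R : ℝ}
    (hid : ∀ x, R ≤ ‖x‖ → F x = x) : ∃ x, F x = 0 := by
  by_contra! hne
  let e := toEuclidean (E := W)
  have : Nontrivial (EuclideanSpace ℝ (Fin (Module.finrank ℝ W))) :=
    e.symm.toEquiv.nontrivial
  let T : W →L[ℝ] EuclideanSpace ℝ (Fin (Module.finrank ℝ W)) := e
  set r : ℝ := ‖T‖ * |R| + 1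
  have hr : 0 < r := by positivity
  have hnorm : ∀ y, r ≤ ‖y‖ → R ≤ ‖e.symm y‖ := by
    intro y hy
    by_contra! hlt
    have h1 := T.le_opNorm (e.symm y)
    have h2 : ‖T‖ * ‖e.symm y‖ ≤ ‖T‖ * |R| := by
      gcongr
      exact hlt.le.trans (le_abs_self R)
    have h3 : T (e.symm y) = y := e.apply_symm_apply y
    rw [h3] at h1
    linarith
  let G := fun y => e (F (e.symm y))
  have hG : Continuous G := e.continuous.comp (hF.comp e.symm.continuous)
  have hG0 : ∀ y, G y ≠ 0 := fun y => by simp [G, hne]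
  have hGid : ∀ y, r ≤ ‖y‖ → G y = y := fun y hy => by simp [G, hid _ (hnorm y hy)]
  obtain ⟨g, hgs, hgd, hge, -⟩ := hG.exists_contDiff_approx_and_eqOn 1 hG.norm
    (fun y => norm_pos_iff.2 (hG0 y)) (S := {y | r + 1 ≤ ‖y‖}) (U := {y | r < ‖y‖})
    (isClosed_le continuous_const continuous_norm)
    ((isOpen_lt continuous_const continuous_norm).mem_nhdsSet.2 fun y hy => by
      simp only [mem_ofPred_eq] at hy ⊢; linarith)
    (contDiffOn_id.congr fun y hy => hGid y (le_of_lt hy))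
  have hg0 : ∀ y, g y ≠ 0 := fun y h0 => by simpa [h0] using hgd y
  refine not_exists_contDiff_retraction (r := r + 1) (by positivity)
    (g := fun y => ((r + 1) * ‖g y‖⁻¹) • g y) ?_ (fun y => ?_) fun y hy => ?_
  · exact (contDiff_const.mul ((hgs.norm ℝ hg0).inv fun y => norm_ne_zero_iff.2 (hg0 y))).smul hgs
  · have := norm_pos_iff.2 (hg0 y)
    rw [norm_smul, Real.norm_of_nonneg (by positivity)]
    field_simp
  · have h1 : g y = y := (hge (show r + 1 ≤ ‖y‖ from hy.ge)).trans (hGid y (by linarith))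
    simp only [h1, hy]
    rw [mul_inv_cancel₀ (by positivity), one_smul]

/-- A sphere, for a continuous gauge `ν`, is not contractible in the complement of the origin. -/
theorem not_homotopic_const_of_gauge {W : Type*} [NormedAddCommGroup W] [NormedSpace ℝ W]
    [FiniteDimensional ℝ W] [Nontrivial W] {ν : W → ℝ} (hν : Continuous ν)
    (hhom : ∀ (c : ℝ) (x : W), 0 ≤ c → ν (c • x) = c * ν x) (hle : ∀ x, ‖x‖ ≤ ν x)
    (ι : C({x : W // ν x = 1}, {x : W // x ≠ 0})) (hι : ∀ x, (ι x : W) = x)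
    (p : {x : W // x ≠ 0}) :
    ¬ ι.Homotopic (ContinuousMap.const _ p) := by
  rintro ⟨H⟩
  have hpos : ∀ x, x ≠ 0 → 0 < ν x := fun x hx => (norm_pos_iff.2 hx).trans_le (hle x)
  have hν0 : ν 0 = 0 := by simpa using hhom 0 0 le_rfl
  let n : {x : W // x ≠ 0} → {x : W // ν x = 1} := fun x =>
    ⟨(ν x)⁻¹ • (x : W), by
      rw [hhom _ _ (inv_nonneg.2 (hpos x x.2).le), inv_mul_cancel₀ (hpos x x.2).ne']⟩
  have hn : Continuous n := by
    refine Continuous.subtype_mk (Continuous.smul (Continuous.inv₀ ?_ ?_) continuous_subtype_val) _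
    · fun_prop
    · exact fun x => (hpos x x.2).ne'
  let τ : W → unitInterval := fun x => projIcc 0 1 zero_le_one (2 - 2 * ν x)
  have hτ : Continuous τ := continuous_projIcc.comp (by fun_prop)
  let A : {x : W // x ≠ 0} → W := fun x => max (ν x) 1 • (H (τ x, n x) : W)
  have hA : Continuous A := by
    refine Continuous.smul (by fun_prop) ?_
    exact continuous_subtype_val.comp (H.continuous.comp ((hτ.comp continuous_subtype_val).prodMk hn))
  classical
  let F : W → W := fun x => if hx : x = 0 then p else A ⟨x, hx⟩
  have hFsub : ∀ x (hx : x ≠ 0), F x = A ⟨x, hx⟩ := fun x hx => by simp [F, hx]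
  have hFp : ∀ x, ν x ≤ 1 / 2 → F x = p := by
    intro x hx
    by_cases h0 : x = 0
    · simp [F, h0]
    · rw [hFsub x h0]
      have : τ x = 1 := projIcc_of_right_le _ (by linarith)
      simp only [A, this, H.apply_one, max_eq_right (by linarith : ν x ≤ 1), one_smul]
      rfl
  have hFcont : Continuous F := by
    rw [continuous_iff_continuousAt]
    intro x
    by_cases h0 : x = 0
    · have : F =ᶠ[𝓝 x] fun _ => (p : W) := by
        have := hν.continuousAt.eventually (gt_mem_nhds (show ν x < 1 / 2 by rw [h0, hν0]; norm_num))
        filter_upwards [this] with y hy using hFp y hy.le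
      exact continuousAt_const.congr this.symm
    · have hopen : IsOpen {x : W | x ≠ 0} := isOpen_ne
      refine ContinuousOn.continuousAt (s := {x : W | x ≠ 0}) ?_ (hopen.mem_nhds h0)
      rw [continuousOn_iff_continuous_domRestrict]
      refine hA.congr fun y => ?_
      exact (hFsub y y.2).symm
  obtain ⟨x, hx⟩ := exists_eq_zero_of_eq_id_outside hFcont (R := 1) fun x hx => by
    have h0 : x ≠ 0 := by rintro rfl; simp at hx; linarith
    have h1 : 1 ≤ ν x := hx.trans (hle x)
    rw [hFsub x h0]
    have : τ x = 0 := projIcc_of_le_left _ (by linarith)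
    simp only [A, this, H.apply_zero, hι, max_eq_left h1, n]
    rw [smul_inv_smul₀ (hpos x h0).ne']
  by_cases h0 : x = 0
  · rw [hFp x (by rw [h0, hν0]; norm_num)] at hx
    exact p.2 hx
  · rw [hFsub x h0] at hx
    have := smul_eq_zero.1 hx
    rcases this with h | h
    · have := le_max_right (ν x) 1
      simp only at h
      linarith
    · exact (H _).2 h

/-- Intersection lemma: a filling of a homotopy that contracts the sphere of a finite dimensional
subspace away from a ball of the complement `ker P` must meet each small sphere of `ker P`. -/
theorem exists_mem_ker_norm_eq_of_filling {X Y : Type*} [NormedAddCommGroup X] [NormedSpace ℝ X]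
    [NormedAddCommGroup Y] [NormedSpace ℝ Y] [FiniteDimensional ℝ Y]
    (i : Y →L[ℝ] X) (P : X →L[ℝ] Y) (hP : ∀ y, P (i y) = y)
    {ρ δ R : ℝ} (hρ : 0 < ρ) (hδ : 0 < δ) (hδR : δ < R) (x₀ : X)
    (hx₀ : P x₀ = 0 → R ≤ ‖x₀‖) (k : C(unitInterval × Y, X))
    (hk : ∀ t (c : ℝ) y, 0 ≤ c → k (t, c • y) = c • k (t, y))
    (hk0 : ∀ y, k (0, y) = ρ • i y) (hk1 : ∀ y, k (1, y) = ‖y‖ • x₀)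
    (hkR : ∀ t y, ‖y‖ = 1 → P (k (t, y)) = 0 → R ≤ ‖k (t, y)‖)
    (f : C(unitInterval × closedBall (0 : Y) 1, X))
    (hf0 : ∀ y, f (0, y) = ρ • i (y : Y)) (hf1 : ∀ y, f (1, y) = x₀)
    (hfk : ∀ t (y : closedBall (0 : Y) 1), ‖(y : Y)‖ = 1 → f (t, y) = k (t, y)) :
    ∃ z, P (f z) = 0 ∧ ‖f z‖ = δ := by
  by_contra! hne
  let π : X → Y × ℝ := fun x => (P x, ‖x - i (P x)‖)
  have hπ : Continuous π := by fun_prop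
  let ν : Y × ℝ → ℝ := fun w => ‖w.1‖ + |w.2|
  have hν : Continuous ν := by fun_prop
  let S := {w : Y × ℝ // ν w = 1}
  have hS : ∀ w : S, ‖(w : Y × ℝ).1‖ + |(w : Y × ℝ).2| = 1 := fun w => w.2
  let b : S → closedBall (0 : Y) 1 := fun w => ⟨(w : Y × ℝ).1, by
    rw [mem_closedBall_zero_iff]; linarith [hS w, abs_nonneg (w : Y × ℝ).2]⟩
  have hb : Continuous b := Continuous.subtype_mk (by fun_prop) _
  let ι : C(S, {w : Y × ℝ // w ≠ 0}) := ⟨fun w => ⟨w, fun h => by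
    have := hS w; simp [h] at this⟩, Continuous.subtype_mk continuous_subtype_val _⟩
  let p : {w : Y × ℝ // w ≠ 0} := ⟨(0, R - δ), fun h => by
    have := congrArg Prod.snd h; simp at this; linarith⟩
  let H : unitInterval × S → Y × ℝ := fun z =>
    if (z.2 : Y × ℝ).2 ≤ 0 then π (f (z.1, b z.2)) - (0, δ)
    else π (k (z.1, (z.2 : Y × ℝ).1)) + (0, (z.2 : Y × ℝ).2 * R - δ)
  have hfst : Continuous fun z : unitInterval × S => (z.2 : Y × ℝ).1 :=
    continuous_fst.comp (continuous_subtype_val.comp continuous_snd)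
  have hsnd : Continuous fun z : unitInterval × S => (z.2 : Y × ℝ).2 :=
    continuous_snd.comp (continuous_subtype_val.comp continuous_snd)
  have hH : Continuous H := by
    refine Continuous.if_le ?_ ?_ hsnd continuous_const fun z hz => ?_
    · exact (hπ.comp (f.continuous.comp (continuous_fst.prodMk (hb.comp continuous_snd)))).sub
        continuous_const
    · exact (hπ.comp (k.continuous.comp (continuous_fst.prodMk hfst))).add
        (continuous_const.prodMk ((hsnd.mul continuous_const).sub continuous_const))
    · have h1 := hS z.2
      rw [hz, abs_zero, add_zero] at h1
      rw [hfk z.1 (b z.2) h1, hz]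
      ext <;> simp [b, sub_eq_add_neg]
  have hH0 : ∀ z, H z ≠ 0 := by
    rintro ⟨t, w⟩ h0
    by_cases hw : (w : Y × ℝ).2 ≤ 0
    · simp only [H, hw, if_true] at h0
      have h1 : P (f (t, b w)) = 0 := by simpa [π] using congrArg Prod.fst h0
      have h2 := congrArg Prod.snd h0
      simp only [π, h1, map_zero, sub_zero, Prod.snd_sub, Prod.snd_zero] at h2
      exact hne _ h1 (by linarith)
    · simp only [H, hw, if_false] at h0
      have h1 : P (k (t, (w : Y × ℝ).1)) = 0 := by simpa [π] using congrArg Prod.fst h0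
      have h2 := congrArg Prod.snd h0
      simp only [π, h1, map_zero, sub_zero, Prod.snd_add, Prod.snd_zero] at h2
      have h3 := hS w
      rw [abs_of_pos (not_le.1 hw)] at h3
      suffices ‖(w : Y × ℝ).1‖ * R ≤ ‖k (t, (w : Y × ℝ).1)‖ by nlinarith
      by_cases hy : (w : Y × ℝ).1 = 0
      · simp [hy]
      · have hy' := norm_pos_iff.2 hy
        have h4 := hk t ‖(w : Y × ℝ).1‖ (‖(w : Y × ℝ).1‖⁻¹ • (w : Y × ℝ).1) hy'.le
        rw [smul_inv_smul₀ hy'.ne'] at h4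
        have h5 : ‖‖(w : Y × ℝ).1‖⁻¹ • (w : Y × ℝ).1‖ = 1 := by
          rw [norm_smul, norm_inv, norm_norm, inv_mul_cancel₀ hy'.ne']
        rw [h4, map_smul, smul_eq_zero_iff_right hy'.ne'] at h1
        rw [h4, norm_smul, norm_norm]
        gcongr
        exact hkR _ _ h5 h1
  let Hs : C(unitInterval × S, {w : Y × ℝ // w ≠ 0}) :=
    ⟨fun z => ⟨H z, hH0 z⟩, hH.subtype_mk _⟩
  let g₀ : C(S, {w : Y × ℝ // w ≠ 0}) := Hs.comp ((ContinuousMap.const S 0).prodMk (.id S))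
  let g₁ : C(S, {w : Y × ℝ // w ≠ 0}) := Hs.comp ((ContinuousMap.const S 1).prodMk (.id S))
  have hg₀ : ∀ w, (g₀ w : Y × ℝ) = (ρ • (w : Y × ℝ).1, max (w : Y × ℝ).2 0 * R - δ) := by
    intro w
    change H (0, w) = _
    by_cases hw : (w : Y × ℝ).2 ≤ 0
    · simp [H, hw, hf0, π, hP, b]
    · simp [H, hw, hk0, π, hP, max_eq_left (not_le.1 hw).le]
  have hg₁ : ∀ w, (g₁ w : Y × ℝ) = ((1 - max (w : Y × ℝ).2 0) • P x₀,
      (1 - max (w : Y × ℝ).2 0) * ‖x₀ - i (P x₀)‖ + (max (w : Y × ℝ).2 0 * R - δ)) := by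
    intro w
    change H (1, w) = _
    by_cases hw : (w : Y × ℝ).2 ≤ 0
    · simp [H, hw, hf1, π, sub_eq_add_neg]
    · have h3 := hS w
      rw [abs_of_pos (not_le.1 hw)] at h3
      have h4 : ‖(w : Y × ℝ).1‖ = 1 - (w : Y × ℝ).2 := by linarith
      have h5 : ‖1 - (w : Y × ℝ).2‖ = 1 - (w : Y × ℝ).2 := by rw [← h4, norm_norm]
      simp [H, hw, hk1, π, h4, max_eq_left (not_le.1 hw).le, ← smul_sub, norm_smul]
      left
      simpa using h5
  have hι₀ : ι.Homotopic g₀ := by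
    refine ⟨⟨⟨fun z => ⟨(1 - (z.1 : ℝ)) • (ι z.2 : Y × ℝ) + (z.1 : ℝ) • (g₀ z.2 : Y × ℝ), ?_⟩, ?_⟩,
      fun w => ?_, fun w => ?_⟩⟩
    · obtain ⟨s, w⟩ := z
      intro h0
      have hs0 := s.2.1
      have hs1 := s.2.2
      rw [hg₀] at h0
      have h1 : ((1 - (s : ℝ)) + s * ρ) • (w : Y × ℝ).1 = 0 := by
        rw [add_smul, mul_smul]
        exact congrArg Prod.fst h0
      have h2 : (1 - (s : ℝ)) * (w : Y × ℝ).2 + s * (max (w : Y × ℝ).2 0 * R - δ) = 0 :=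
        congrArg Prod.snd h0
      have h3 : (1 - (s : ℝ)) + s * ρ ≠ 0 := by
        rcases hs0.eq_or_lt with h | h
        · rw [← h]; simp
        · nlinarith [mul_pos h hρ]
      have h4 := (smul_eq_zero_iff_right h3).1 h1
      have h5 := hS w
      rw [h4, norm_zero, zero_add] at h5
      rcases (abs_eq zero_le_one).1 h5 with h | h
      · rw [h, max_eq_left zero_le_one] at h2
        rcases hs0.eq_or_lt with h' | h'
        · rw [← h'] at h2; simp at h2
        · nlinarith [mul_pos h' (sub_pos.2 hδR)]
      · rw [h, max_eq_right (by norm_num)] at h2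
        rcases hs0.eq_or_lt with h' | h'
        · rw [← h'] at h2; simp at h2
        · nlinarith [mul_pos h' hδ]
    · refine Continuous.subtype_mk ?_ _
      fun_prop
    · simp
    · simp
  have h₀₁ : g₀.Homotopic g₁ := ⟨⟨Hs, fun _ => rfl, fun _ => rfl⟩⟩
  have h₁ : g₁.Homotopic (ContinuousMap.const _ p) := by
    refine ⟨⟨⟨fun z => ⟨(1 - (z.1 : ℝ)) • (g₁ z.2 : Y × ℝ) + (z.1 : ℝ) • (p : Y × ℝ), ?_⟩, ?_⟩,
      fun w => ?_, fun w => ?_⟩⟩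
    · obtain ⟨s, w⟩ := z
      intro h0
      have hs0 := s.2.1
      have hs1 := s.2.2
      rw [hg₁] at h0
      set m := max (w : Y × ℝ).2 0
      have hm0 : 0 ≤ m := le_max_right _ _
      have hm1 : m ≤ 1 := max_le ((le_abs_self _).trans (by
        linarith [hS w, norm_nonneg (w : Y × ℝ).1])) zero_le_one
      have h1 : ((1 - (s : ℝ)) * (1 - m)) • P x₀ = 0 := by
        have := congrArg Prod.fst h0
        simpa [p, mul_smul] using this
      have h2 : (1 - (s : ℝ)) * ((1 - m) * ‖x₀ - i (P x₀)‖ + (m * R - δ)) + s * (R - δ) = 0 :=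
        congrArg Prod.snd h0
      set q := (1 - (s : ℝ)) * (1 - m)
      have hq : 0 ≤ q := mul_nonneg (by linarith) (by linarith)
      have h3 : q * ‖x₀ - i (P x₀)‖ + (1 - q) * R = δ := by
        simp only [q]; linarith
      rcases smul_eq_zero.1 h1 with h | h
      · rw [h] at h3; linarith
      · have := hx₀ h
        rw [h, map_zero, sub_zero] at h3
        nlinarith
    · refine Continuous.subtype_mk ?_ _
      fun_prop
    · simp
    · simp
  refine not_homotopic_const_of_gauge hν (fun c x hc => ?_) (fun x => ?_) ι (fun _ => rfl) p
    ((hι₀.trans h₀₁).trans h₁)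
  · simp [ν, norm_smul, abs_mul, abs_of_nonneg hc, mul_add]
  · rw [Prod.norm_def, Real.norm_eq_abs]
    exact max_le (le_add_of_nonneg_right (abs_nonneg _)) (le_add_of_nonneg_left (norm_nonneg _))

/-- **Ekeland's variational principle** for continuous functions. -/
theorem exists_ekeland {M : Type*} [MetricSpace M] [CompleteSpace M] {Φ : M → ℝ}
    (hΦ : Continuous Φ) {m : ℝ} (hm : ∀ x, m ≤ Φ x) {ε : ℝ} (hε : 0 < ε) (x₀ : M) :
    ∃ v, Φ v + ε * dist x₀ v ≤ Φ x₀ ∧ ∀ w, Φ v ≤ Φ w + ε * dist v w := by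
  let S : M → Set M := fun x => {w | Φ w + ε * dist x w ≤ Φ x}
  have hself : ∀ x, x ∈ S x := fun x => by simp [S]
  have htrans : ∀ {x y z}, y ∈ S x → z ∈ S y → z ∈ S x := by
    intro x y z hy hz
    simp only [S, mem_ofPred_eq] at *
    nlinarith [dist_triangle x y z]
  have hnext : ∀ (n : ℕ) (x : M), ∃ y ∈ S x, ∀ w ∈ S x, Φ y ≤ Φ w + (1 / 2) ^ n := by
    intro n x
    have hne : (Φ '' S x).Nonempty := ⟨_, mem_image_of_mem _ (hself x)⟩
    have hbd : BddBelow (Φ '' S x) := ⟨m, by rintro _ ⟨w, -, rfl⟩; exact hm w⟩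
    obtain ⟨_, ⟨y, hy, rfl⟩, hlt⟩ := exists_lt_of_csInf_lt hne
      (lt_add_of_pos_right (sInf (Φ '' S x)) (by positivity : (0 : ℝ) < (1 / 2) ^ n))
    exact ⟨y, hy, fun w hw => by linarith [csInf_le hbd (mem_image_of_mem Φ hw)]⟩
  choose next hnS hnle using hnext
  let u : ℕ → M := fun n => Nat.rec x₀ (fun n x => next n x) n
  have hu : ∀ n, u (n + 1) = next n (u n) := fun n => rfl
  have hmem : ∀ n k, u (n + k) ∈ S (u n) := by
    intro n k
    induction k with
    | zero => exact hself _
    | succ k ih => exact htrans ih (by rw [← add_assoc, hu]; exact hnS _ _)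
  have hanti : Antitone fun n => Φ (u n) := by
    refine antitone_nat_of_succ_le fun n => ?_
    have := hmem n 1
    simp only [S, mem_ofPred_eq] at this
    nlinarith [dist_nonneg (x := u n) (y := u (n + 1))]
  have hlim := tendsto_atTop_ciInf hanti ⟨m, by rintro _ ⟨n, rfl⟩; exact hm _⟩
  have hcau : CauchySeq u := by
    have hc := hlim.cauchySeq
    rw [Metric.cauchySeq_iff'] at hc ⊢
    intro η hη
    obtain ⟨N, hN⟩ := hc (ε * η) (by positivity)
    refine ⟨N, fun n hn => ?_⟩
    obtain ⟨k, rfl⟩ := Nat.exists_eq_add_of_le hn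
    have h1 := hmem N k
    have h2 := hN _ hn
    simp only [S, mem_ofPred_eq] at h1
    rw [Real.dist_eq, abs_lt] at h2
    rw [dist_comm]
    exact lt_of_mul_lt_mul_left (by linarith) hε.le
  obtain ⟨v, hv⟩ := cauchySeq_tendsto_of_complete hcau
  have hvS : ∀ n, v ∈ S (u n) := by
    intro n
    have hcl : IsClosed (S (u n)) := isClosed_le (by fun_prop) continuous_const
    refine hcl.mem_of_tendsto hv ?_
    filter_upwards [eventually_ge_atTop n] with j hj
    obtain ⟨k, rfl⟩ := Nat.exists_eq_add_of_le hj
    exact hmem n k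
  refine ⟨v, hvS 0, fun w => ?_⟩
  by_cases hw : w ∈ S v
  · have h1 : ∀ n, Φ (u (n + 1)) ≤ Φ w + (1 / 2) ^ n := fun n => hnle n (u n) w (htrans (hvS n) hw)
    have h2 : Tendsto (fun n : ℕ => Φ w + (1 / 2 : ℝ) ^ n) atTop (𝓝 (Φ w + 0)) :=
      tendsto_const_nhds.add (tendsto_pow_atTop_nhds_zero_of_lt_one (by norm_num) (by norm_num))
    have h3 : Tendsto (fun n => Φ (u (n + 1))) atTop (𝓝 (Φ v)) :=
      (hΦ.tendsto v).comp (hv.comp (tendsto_add_atTop_nat 1))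
    have h4 := le_of_tendsto_of_tendsto' h3 h2 h1
    have : 0 ≤ ε * dist v w := by positivity
    linarith
  · simp only [S, mem_ofPred_eq, not_le] at hw
    exact hw.le

theorem HasFDerivAt.norm_le_of_eventually_le {X : Type*} [NormedAddCommGroup X] [NormedSpace ℝ X]
    {φ : X → ℝ} {A : X →L[ℝ] ℝ} {v : X} (hφ : HasFDerivAt φ A v) {ε : ℝ} (hε : 0 ≤ ε)
    (h : ∀ᶠ w in 𝓝 v, φ v ≤ φ w + ε * dist v w) : ‖A‖ ≤ ε := by
  have key : ∀ y, -(A y) ≤ ε * ‖y‖ := by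
    intro y
    have hd : HasDerivAt (fun t : ℝ => φ (v + t • y)) (A y) 0 := hφ.hasLineDerivAt y
    have h1 := hd.hasDerivWithinAt (s := Ioi 0)
    rw [hasDerivWithinAt_iff_tendsto_slope' (by simp)] at h1
    have h2 : ∀ᶠ t : ℝ in 𝓝[>] 0, -(ε * ‖y‖) ≤ slope (fun t : ℝ => φ (v + t • y)) 0 t := by
      have hc : Tendsto (fun t : ℝ => v + t • y) (𝓝[>] 0) (𝓝 v) := by
        have : Continuous fun t : ℝ => v + t • y := by fun_prop
        simpa using (this.tendsto 0).mono_left nhdsWithin_le_nhds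
      filter_upwards [hc.eventually h, self_mem_nhdsWithin] with t ht ht0
      have ht0 : 0 < t := ht0
      rw [slope_def_field, sub_zero, zero_smul, add_zero, le_div_iff₀ ht0]
      rw [dist_self_add_right, norm_smul, Real.norm_of_nonneg ht0.le] at ht
      linarith
    linarith [ge_of_tendsto h1 h2]
  refine A.opNorm_le_bound hε fun y => ?_
  rw [Real.norm_eq_abs, abs_le]
  have h1 := key y
  have h2 := key (-y)
  rw [map_neg, norm_neg] at h2
  constructor <;> linarith

/-- First order descent for a compact family of points: near a closed set of parameters on which
`‖φ'‖ > ε`, all points can be moved simultaneously so that `φ` decreases at rate `ε`. -/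
theorem exists_descent_direction {X Z : Type*} [NormedAddCommGroup X] [NormedSpace ℝ X]
    [TopologicalSpace Z] [CompactSpace Z] [T2Space Z] {φ : X → ℝ} {φ' : X → X →L[ℝ] ℝ}
    (hφ : ∀ x, HasFDerivAt φ (φ' x) x) (hφ' : Continuous φ') (f : C(Z, X)) {M B : Set Z}
    (hM : IsClosed M) (hB : IsClosed B) (hMB : Disjoint M B) {ε : ℝ}
    (hMε : ∀ z ∈ M, ε < ‖φ' (f z)‖) :
    ∃ (χ : C(Z, ℝ)) (w : C(Z, X)) (σ : ℝ), (∀ z, χ z ∈ Icc (0 : ℝ) 1) ∧ (∀ z ∈ M, χ z = 1) ∧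
      (∀ z ∈ B, χ z = 0) ∧ (∀ z, ‖w z‖ ≤ 1) ∧ 0 < σ ∧
      ∀ s ∈ Icc 0 σ, ∀ z, φ (f z - (s * χ z) • w z) ≤ φ (f z) - ε * (s * χ z) := by
  have hO : IsOpen ({z | ε < ‖φ' (f z)‖} ∩ Bᶜ) :=
    (isOpen_lt continuous_const (by fun_prop)).inter hB.isOpen_compl
  obtain ⟨U, hU, hMU, hUO⟩ := normal_exists_closure_subset hM hO fun z hz =>
    ⟨hMε z hz, disjoint_left.1 hMB hz⟩
  obtain ⟨χ, hχ0, hχ1, hχ⟩ := exists_continuous_zero_one_of_isClosed hU.isClosed_compl hM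
    (disjoint_left.2 fun z hz hzM => hz (hMU hzM))
  obtain ⟨w, hw⟩ := exists_continuous_forall_mem_convex_of_local_const
    (t := fun z => {v : X | ‖v‖ ≤ 1 ∧ (z ∈ closure U → ε < φ' (f z) v)})
    (fun z => by
      intro x hx y hy a b ha hb hab
      refine ⟨?_, fun hz => ?_⟩
      · calc ‖a • x + b • y‖ ≤ a * ‖x‖ + b * ‖y‖ := by
              refine (norm_add_le _ _).trans ?_
              rw [norm_smul, norm_smul, Real.norm_of_nonneg ha, Real.norm_of_nonneg hb]
          _ ≤ 1 := by nlinarith [hx.1, hy.1]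
      · have := convex_Ioi ε (hx.2 hz) (hy.2 hz) ha hb hab
        simpa using this)
    (fun z => by
      by_cases hz : z ∈ closure U
      · obtain ⟨v, hv1, hv⟩ := (φ' (f z)).exists_lt_apply_of_lt_opNorm (hUO hz).1
        obtain ⟨u, hu1, hu⟩ : ∃ u : X, ‖u‖ ≤ 1 ∧ ε < φ' (f z) u := by
          rcases abs_cases (φ' (f z) v) with h | h
          · exact ⟨v, hv1.le, by rwa [Real.norm_eq_abs, h.1] at hv⟩
          · exact ⟨-v, by rw [norm_neg]; exact hv1.le, by rwa [map_neg, ← h.1]⟩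
        refine ⟨u, ?_⟩
        have hc : Continuous fun z => φ' (f z) u := by fun_prop
        filter_upwards [hc.continuousAt.eventually (lt_mem_nhds hu)] with y hy
        exact ⟨hu1, fun _ => hy⟩
      · refine ⟨0, ?_⟩
        filter_upwards [isClosed_closure.isOpen_compl.mem_nhds hz] with y hy
        exact ⟨by simp, fun h => absurd h hy⟩)
  have htube : ∀ᶠ r : ℝ in 𝓝 0, ∀ z ∈ closure U, ε < φ' (f z - r • w z) (w z) := by
    refine isClosed_closure.isCompact.eventually_forall_of_forall_eventually fun z hz => ?_
    have hc : Continuous fun q : ℝ × Z => φ' (f q.2 - q.1 • w q.2) (w q.2) := by fun_prop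
    refine hc.continuousAt.eventually (lt_mem_nhds ?_)
    simpa using (hw z).2 hz
  obtain ⟨σ, hσ, hσt⟩ := Metric.eventually_nhds_iff.1 htube
  refine ⟨χ, w, σ / 2, hχ, fun z hz => hχ1 hz, fun z hz => ?_, fun z => (hw z).1, by positivity,
    fun s hs z => ?_⟩
  · exact hχ0 fun hzU => (hUO (subset_closure hzU)).2 hz
  by_cases hzU : z ∈ U
  · have hle : s * χ z ≤ σ / 2 := by nlinarith [hs.1, hs.2, (hχ z).1, (hχ z).2]
    have hd : ∀ r, HasDerivAt (fun r : ℝ => φ (f z - r • w z) + ε * r)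
        (-(φ' (f z - r • w z) (w z)) + ε) r := by
      intro r
      have h1 : HasDerivAt (fun r : ℝ => f z - r • w z) (-w z) r := by
        simpa using ((hasDerivAt_id r).smul_const (w z)).const_sub (f z)
      exact (((hφ _).comp_hasDerivAt r h1).add ((hasDerivAt_id r).const_mul ε)).congr_deriv (by simp)
    have hanti := antitoneOn_of_hasDerivWithinAt_nonpos (convex_Icc 0 (σ / 2))
      (fun r _ => (hd r).continuousAt.continuousWithinAt) (fun r _ => (hd r).hasDerivWithinAt)
      (fun r hr => by
        rw [interior_Icc] at hr
        have := hσt (y := r) (by rw [Real.dist_eq, sub_zero, abs_of_pos hr.1]; linarith [hr.2])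
          z (subset_closure hzU)
        linarith)
    have hnn := mul_nonneg hs.1 (hχ z).1
    have := hanti ⟨le_rfl, by positivity⟩ ⟨hnn, hle⟩ hnn
    simp at this
    linarith
  · simp [show χ z = 0 from hχ0 hzU]

/-- Relative descent principle: a family `f₁` of points parametrized by a compact space can be
deformed, keeping it fixed on `B` and keeping `φ ≤ b`, without increasing the maximum of `φ + p`
over `E`, to a family for which this maximum is attained on `B` or at an almost critical point. -/
theorem exists_deformed_max_almost_critical {X Z : Type*} [NormedAddCommGroup X] [NormedSpace ℝ X]
    [CompleteSpace X] [TopologicalSpace Z] [CompactSpace Z] [T2Space Z] {φ : X → ℝ}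
    {φ' : X → X →L[ℝ] ℝ} (hφ : ∀ x, HasFDerivAt φ (φ' x) x) (hφ' : Continuous φ') (f₁ : C(Z, X))
    {E B : Set Z} (hE : IsClosed E) (hEne : E.Nonempty) (hB : IsClosed B) {ε : ℝ} (hε : 0 < ε)
    {p : X → ℝ} (hpc : Continuous p) (hp : ∀ x y, p x ≤ p y + ε / 4 * ‖x - y‖) {m : ℝ}
    (hm : ∀ x, m ≤ φ x + p x) {b : ℝ} (hb : ∀ z, φ (f₁ z) ≤ b) :
    ∃ f : C(Z, X), (∀ z ∈ B, f z = f₁ z) ∧ (∀ z, φ (f z) ≤ b) ∧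
      (∀ c, (∀ z ∈ E, φ (f₁ z) + p (f₁ z) ≤ c) → ∀ z ∈ E, φ (f z) + p (f z) ≤ c) ∧
      ∃ z ∈ E, (∀ z' ∈ E, φ (f z') + p (f z') ≤ φ (f z) + p (f z)) ∧
        (z ∈ B ∨ ‖φ' (f z)‖ ≤ ε) := by
  have hφc : Continuous φ := continuous_iff_continuousAt.2 fun x => (hφ x).continuousAt
  let ψ : X → ℝ := fun x => φ x + p x
  have hψ : Continuous ψ := hφc.add hpc
  let N : Set C(Z, X) := {f | (∀ z ∈ B, f z = f₁ z) ∧ ∀ z, φ (f z) ≤ b}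
  have hN : IsClosed N := by
    have : N = (⋂ z ∈ B, {f : C(Z, X) | f z = f₁ z}) ∩ ⋂ z, {f : C(Z, X) | φ (f z) ≤ b} := by
      ext f; simp [N]
    rw [this]
    exact (isClosed_biInter fun z _ => isClosed_eq (by fun_prop) continuous_const).inter
      (isClosed_iInter fun z => isClosed_le (by fun_prop) continuous_const)
  have : CompleteSpace N := hN.completeSpace_coe
  have hEc : IsCompact E := hE.isCompact
  let Φ : N → ℝ := fun f => sSup ((fun z => ψ (f.1 z)) '' E)
  have hΦ : Continuous Φ := hEc.continuous_sSup
    (f := fun (f : N) z => ψ (f.1 z)) (by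
      change Continuous fun q : N × Z => ψ (q.1.1 q.2)
      exact hψ.comp (continuous_eval.comp
        ((continuous_subtype_val.comp continuous_fst).prodMk continuous_snd)))
  have hbdd : ∀ f : N, BddAbove ((fun z => ψ (f.1 z)) '' E) := fun f =>
    (hEc.image (hψ.comp f.1.continuous)).bddAbove
  have hle : ∀ (f : N), ∀ z ∈ E, ψ (f.1 z) ≤ Φ f := fun f z hz =>
    le_csSup (hbdd f) (mem_image_of_mem _ hz)
  have hΦle : ∀ (f : N) c, (∀ z ∈ E, ψ (f.1 z) ≤ c) → Φ f ≤ c := fun f c h =>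
    csSup_le (hEne.image _) (by rintro _ ⟨z, hz, rfl⟩; exact h z hz)
  obtain ⟨z₀, hz₀⟩ := hEne
  obtain ⟨f, hf1, hf⟩ := exists_ekeland hΦ (fun f => (hm _).trans (hle f z₀ hz₀))
    (by positivity : 0 < ε / 4) ⟨f₁, fun _ _ => rfl, hb⟩
  refine ⟨f, f.2.1, f.2.2, fun c hc z hz => ?_, ?_⟩
  · refine (hle f z hz).trans ?_
    have h1 := hΦle ⟨f₁, fun _ _ => rfl, hb⟩ c hc
    have h2 : 0 ≤ ε / 4 * dist (⟨f₁, fun _ _ => rfl, hb⟩ : N) f := by positivity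
    linarith
  by_contra! hne
  let M : Set Z := {z | z ∈ E ∧ Φ f ≤ ψ (f.1 z)}
  have hM : IsClosed M := hE.inter (isClosed_le continuous_const (hψ.comp f.1.continuous))
  have hMne : ∀ z ∈ M, z ∉ B ∧ ε < ‖φ' (f.1 z)‖ := fun z hz =>
    hne z hz.1 fun z' hz' => (hle f z' hz').trans hz.2
  obtain ⟨χ, w, σ, hχ, hχM, hχB, hw, hσ, hdesc⟩ := exists_descent_direction hφ hφ' f.1 hM hB
    (disjoint_left.2 fun z hz => (hMne z hz).1) fun z hz => (hMne z hz).2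
  obtain ⟨κ, hκ, hgap⟩ : ∃ κ > 0, ∀ z ∈ E, χ z ≤ 2 / 3 → ψ (f.1 z) ≤ Φ f - κ := by
    have hK : IsCompact (E ∩ {z | χ z ≤ 2 / 3}) :=
      (hE.inter (isClosed_le χ.continuous continuous_const)).isCompact
    rcases (E ∩ {z | χ z ≤ 2 / 3}).eq_empty_or_nonempty with h | h
    · refine ⟨1, one_pos, fun z hz hz' => ?_⟩
      have : z ∈ E ∩ {z | χ z ≤ 2 / 3} := ⟨hz, hz'⟩
      simp [h] at this
    · obtain ⟨z, hz, hzm⟩ := hK.exists_isMaxOn h (hψ.comp f.1.continuous).continuousOn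
      refine ⟨Φ f - ψ (f.1 z), ?_, fun z' h1 h2 => ?_⟩
      · by_contra! hcon
        have h1 := hχM z ⟨hz.1, by linarith⟩
        have h2 : χ z ≤ 2 / 3 := hz.2
        linarith
      · have h3 : ψ (f.1 z') ≤ ψ (f.1 z) := hzm (show z' ∈ _ from ⟨h1, h2⟩)
        linarith
  let s := min σ (2 * κ / ε)
  have hs : 0 < s := lt_min hσ (by positivity)
  have hsκ : ε * s / 2 ≤ κ := by
    have : s ≤ 2 * κ / ε := min_le_right _ _
    rw [le_div_iff₀ hε] at this
    linarith
  have hsσ : s ∈ Icc 0 σ := ⟨hs.le, min_le_left _ _⟩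
  let g₀ : C(Z, X) := ⟨fun z => f.1 z - (s * χ z) • w z, by fun_prop⟩
  have hnn : ∀ z, 0 ≤ s * χ z := fun z => mul_nonneg hs.le (hχ z).1
  have hd : ∀ z, φ (g₀ z) ≤ φ (f.1 z) - ε * (s * χ z) := fun z => hdesc s hsσ z
  have hpd : ∀ z, p (g₀ z) ≤ p (f.1 z) + ε / 4 * (s * χ z) := by
    intro z
    refine (hp _ (f.1 z)).trans ?_
    have : ‖g₀ z - f.1 z‖ ≤ s * χ z := by
      simp only [g₀, ContinuousMap.coe_mk, sub_sub_cancel_left, norm_neg, norm_smul,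
        Real.norm_of_nonneg (hnn z)]
      exact mul_le_of_le_one_right (hnn z) (hw z)
    gcongr
  let g : N := ⟨g₀, fun z hz => by simp [g₀, hχB z hz, f.2.1 z hz], fun z =>
    (hd z).trans (by nlinarith [f.2.2 z, hnn z])⟩
  have hdist : dist f g ≤ s := by
    refine (ContinuousMap.dist_le hs.le).2 fun z => ?_
    rw [dist_eq_norm]
    simp only [g, g₀, ContinuousMap.coe_mk, sub_sub_cancel, norm_smul, Real.norm_of_nonneg (hnn z)]
    exact mul_le_of_le_one_right (hnn z) (hw z) |>.trans (mul_le_of_le_one_right hs.le (hχ z).2)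
  have hΦg : Φ g ≤ Φ f - ε * s / 2 := by
    refine hΦle g _ fun z hz => ?_
    have h1 : ψ (g.1 z) ≤ ψ (f.1 z) - 3 / 4 * ε * (s * χ z) := by
      have h2 := hd z
      have h3 := hpd z
      simp only [ψ, g]
      linarith
    by_cases hz' : χ z ≤ 2 / 3
    · have h2 := hgap z hz hz'
      have h3 : 0 ≤ 3 / 4 * ε * (s * χ z) := mul_nonneg (by positivity) (hnn z)
      linarith
    · have h2 := hle f z hz
      have h3 : 2 / 3 * (ε * s) ≤ χ z * (ε * s) := by
        have := (not_le.1 hz').le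
        gcongr
      nlinarith
  have := hf g
  nlinarith [mul_pos hε hs]

/-- The Cerami condition for a functional `φ` with derivative `φ'`. -/
def SatisfiesCerami {X : Type*} [NormedAddCommGroup X] [NormedSpace ℝ X] (φ : X → ℝ)
    (φ' : X → X →L[ℝ] ℝ) : Prop :=
  ∀ u : ℕ → X, (∃ C : ℝ, ∀ n, |φ (u n)| ≤ C) →
    Tendsto (fun n => (1 + ‖u n‖) * ‖φ' (u n)‖) atTop (𝓝 0) →
    ∃ (w : X) (σ : ℕ → ℕ), StrictMono σ ∧ Tendsto (u ∘ σ) atTop (𝓝 w)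

namespace SatisfiesCerami

variable {X : Type*} [NormedAddCommGroup X] [NormedSpace ℝ X] [CompleteSpace X] {φ : X → ℝ}
  {φ' : X → X →L[ℝ] ℝ}

/-- A functional that is bounded below and satisfies the Cerami condition is coercive. -/
theorem exists_norm_le (hC : SatisfiesCerami φ φ') (hφ : ∀ x, HasFDerivAt φ (φ' x) x) {m : ℝ}
    (hm : ∀ x, m ≤ φ x) (C : ℝ) : ∃ R, ∀ x, φ x ≤ C → ‖x‖ ≤ R := by
  by_contra! hne
  have hφc : Continuous φ := continuous_iff_continuousAt.2 fun x => (hφ x).continuousAt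
  let a : ℕ → ℝ := fun n => sInf (φ '' {x | (n : ℝ) ≤ ‖x‖})
  have hbd : ∀ n : ℕ, BddBelow (φ '' {x | (n : ℝ) ≤ ‖x‖}) := fun n =>
    ⟨m, by rintro _ ⟨x, -, rfl⟩; exact hm x⟩
  have hale : ∀ (n : ℕ) x, (n : ℝ) ≤ ‖x‖ → a n ≤ φ x := fun n x hx =>
    csInf_le (hbd n) (mem_image_of_mem _ hx)
  have haC : ∀ n, a n ≤ C := fun n => by
    obtain ⟨x, hx, hn⟩ := hne n
    exact (hale n x hn.le).trans hx
  have habd : BddAbove (range a) := ⟨C, by rintro _ ⟨n, rfl⟩; exact haC n⟩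
  have hamono : Monotone a := by
    refine fun n k hnk => csInf_le_csInf (hbd n) ?_ (image_mono fun x hx => ?_)
    · obtain ⟨x, -, hn⟩ := hne k
      exact ⟨_, mem_image_of_mem _ hn.le⟩
    · exact (Nat.cast_le (α := ℝ).2 hnk).trans (show (k : ℝ) ≤ ‖x‖ from hx)
  set L := ⨆ n, a n
  have key : ∀ n : ℕ, ∃ v, |φ v| ≤ |L| + 1 ∧ (n : ℝ) ≤ ‖v‖ ∧
      (1 + ‖v‖) * ‖φ' v‖ ≤ 14 * (1 / ((n : ℝ) + 1)) := by
    intro n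
    set η : ℝ := 1 / ((n : ℝ) + 1) with hηdef
    have hη : 0 < η := by positivity
    have hη1 : η ≤ 1 := by rw [hηdef, div_le_one (by positivity)]; linarith [n.cast_nonneg (α := ℝ)]
    obtain ⟨N, hN⟩ := exists_lt_of_lt_ciSup (sub_lt_self L hη)
    let k := max N (n + 1)
    have hk : L - η < a k := hN.trans_le (hamono (le_max_left _ _))
    have hkn : (n : ℝ) + 1 ≤ k := by exact_mod_cast le_max_right N (n + 1)
    have h2 : a (2 * k) < L + η := (le_ciSup habd _).trans_lt (lt_add_of_pos_right _ hη)
    obtain ⟨_, ⟨u, hu, rfl⟩, huL⟩ := exists_lt_of_csInf_lt (by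
      obtain ⟨x, -, hn⟩ := hne (2 * k : ℕ)
      exact ⟨_, mem_image_of_mem _ hn.le⟩) h2
    have hu : 2 * (k : ℝ) ≤ ‖u‖ := by simpa using hu
    have hn0 : (0 : ℝ) ≤ n := n.cast_nonneg
    have hu0 : 0 < ‖u‖ := by linarith
    let M : Set X := {x | (k : ℝ) ≤ ‖x‖}
    have hM : IsClosed M := isClosed_le continuous_const continuous_norm
    have : CompleteSpace M := hM.completeSpace_coe
    have hε : 0 < 8 * η / ‖u‖ := by positivity
    obtain ⟨⟨v, hvM⟩, hv1, hv⟩ := exists_ekeland (Φ := fun x : M => φ x)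
      (hφc.comp continuous_subtype_val) (fun x => hale k x x.2) hε
      ⟨u, show (k : ℝ) ≤ ‖u‖ by linarith⟩
    have hd : ‖u - v‖ ≤ ‖u‖ / 4 := by
      have h3 := hale k v hvM
      simp only [Subtype.dist_eq, dist_eq_norm] at hv1
      have h4 : 8 * η / ‖u‖ * ‖u - v‖ ≤ 2 * η := by linarith
      have h5 : 8 * η / ‖u‖ * ‖u - v‖ = 8 * η * ‖u - v‖ / ‖u‖ := by ring
      rw [h5, div_le_iff₀ hu0] at h4
      exact le_of_mul_le_mul_left (by linarith) (by positivity : 0 < 8 * η)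
    have hvu := norm_sub_norm_le u v
    have hvu' := norm_sub_norm_le v u
    rw [norm_sub_rev] at hvu'
    have hvd : ‖φ' v‖ ≤ 8 * η / ‖u‖ := by
      refine (hφ v).norm_le_of_eventually_le hε.le ?_
      filter_upwards [(isOpen_lt continuous_const continuous_norm).mem_nhds
        (show (k : ℝ) < ‖v‖ by linarith)] with w hw
      exact hv ⟨w, hw.le⟩
    refine ⟨v, ?_, by linarith, ?_⟩
    · have h3 := hale k v hvM
      have h4 : φ v ≤ φ u := by
        have : 0 ≤ 8 * η / ‖u‖ * dist (⟨u, show (k : ℝ) ≤ ‖u‖ by linarith⟩ : M) ⟨v, hvM⟩ := by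
          positivity
        linarith
      rw [abs_le]
      constructor <;> linarith [le_abs_self L, neg_abs_le L]
    · calc (1 + ‖v‖) * ‖φ' v‖ ≤ (7 / 4 * ‖u‖) * (8 * η / ‖u‖) := by
            gcongr
            linarith
        _ = 14 * η := by field_simp; norm_num
  choose v hv1 hv2 hv3 using key
  obtain ⟨w, σ, hσ, hw⟩ := hC v ⟨_, hv1⟩ (squeeze_zero (fun n => by positivity) hv3
    (by simpa using tendsto_one_div_add_atTop_nhds_zero_nat.const_mul (14 : ℝ)))
  refine not_tendsto_nhds_of_tendsto_atTop ?_ _ hw.norm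
  exact tendsto_atTop_mono (fun n => hv2 (σ n)) (tendsto_natCast_atTop_atTop.comp hσ.tendsto_atTop)

/-- Almost critical points at levels close to `c` on which the continuous function `d` is almost
nonpositive yield a critical point at level `c` with `d ≤ 0`. -/
theorem exists_critical_point (hC : SatisfiesCerami φ φ') (hφ : ∀ x, HasFDerivAt φ (φ' x) x)
    (hφ' : Continuous φ') {m : ℝ} (hm : ∀ x, m ≤ φ x) {d : X → ℝ} (hd : Continuous d) {c : ℝ}
    (h : ∀ ε > 0, ∃ u, |φ u - c| ≤ ε ∧ ‖φ' u‖ ≤ ε ∧ d u ≤ ε) :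
    ∃ w, φ w = c ∧ φ' w = 0 ∧ d w ≤ 0 := by
  have hφc : Continuous φ := continuous_iff_continuousAt.2 fun x => (hφ x).continuousAt
  choose u hu1 hu2 hu3 using fun n : ℕ => h (1 / ((n : ℝ) + 1)) (by positivity)
  have h0 : Tendsto (fun n : ℕ => 1 / ((n : ℝ) + 1)) atTop (𝓝 0) :=
    tendsto_one_div_add_atTop_nhds_zero_nat
  have hle : ∀ n, |φ (u n)| ≤ |c| + 1 := fun n => by
    have h1 : 1 / ((n : ℝ) + 1) ≤ 1 := by
      rw [div_le_one (by positivity)]; linarith [n.cast_nonneg (α := ℝ)]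
    have h2 := abs_sub_abs_le_abs_sub (φ (u n)) c
    linarith [hu1 n]
  obtain ⟨R, hR⟩ := hC.exists_norm_le hφ hm (|c| + 1)
  have hlim : Tendsto (fun n => (1 + ‖u n‖) * ‖φ' (u n)‖) atTop (𝓝 0) := by
    refine squeeze_zero (fun n => by positivity) (fun n => ?_)
      (by simpa only [mul_zero] using h0.const_mul (1 + R))
    have h1 := hR (u n) ((le_abs_self _).trans (hle n))
    have h2 := hu2 n
    have h3 := norm_nonneg (u n)
    gcongr
    linarith
  obtain ⟨w, σ, hσ, hw⟩ := hC u ⟨_, hle⟩ hlim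
  have h0σ := h0.comp hσ.tendsto_atTop
  refine ⟨w, ?_, ?_, ?_⟩
  · have h1 : Tendsto (fun n => |φ (u (σ n)) - c|) atTop (𝓝 |φ w - c|) :=
      ((hφc.tendsto w).comp hw |>.sub_const c).abs
    have h2 := le_of_tendsto_of_tendsto' h1 h0σ fun n => hu1 (σ n)
    exact sub_eq_zero.1 (abs_nonpos_iff.1 h2)
  · have h1 : Tendsto (fun n => ‖φ' (u (σ n))‖) atTop (𝓝 ‖φ' w‖) := ((hφ'.tendsto w).comp hw).norm
    exact norm_le_zero_iff.1 (le_of_tendsto_of_tendsto' h1 h0σ fun n => hu2 (σ n))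
  · exact le_of_tendsto_of_tendsto' ((hd.tendsto w).comp hw) h0σ fun n => hu3 (σ n)

theorem exists_isMinOn (hC : SatisfiesCerami φ φ') (hφ : ∀ x, HasFDerivAt φ (φ' x) x)
    (hφ' : Continuous φ') (hbd : BddBelow (range φ)) :
    ∃ x₀, φ' x₀ = 0 ∧ ∀ x, φ x₀ ≤ φ x := by
  have hφc : Continuous φ := continuous_iff_continuousAt.2 fun x => (hφ x).continuousAt
  have hm : ∀ x, sInf (range φ) ≤ φ x := fun x => csInf_le hbd (mem_range_self x)
  obtain ⟨w, hw, hw', -⟩ := hC.exists_critical_point hφ hφ' hm (continuous_const (y := (0 : ℝ)))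
    (c := sInf (range φ)) fun ε hε => by
      obtain ⟨_, ⟨x, rfl⟩, hx⟩ := exists_lt_of_csInf_lt (range_nonempty φ)
        (lt_add_of_pos_right (sInf (range φ)) hε)
      obtain ⟨v, hv1, hv⟩ := exists_ekeland hφc hm hε x
      refine ⟨v, ?_, (hφ v).norm_le_of_eventually_le hε.le (Eventually.of_forall hv), hε.le⟩
      have : 0 ≤ ε * dist x v := by positivity
      rw [abs_of_nonneg (sub_nonneg.2 (hm v))]
      linarith
  exact ⟨w, hw', fun x => hw ▸ hm x⟩

/-- A unique minimizer is strict in the sense that minimizing sequences converge to it. -/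
theorem exists_sublevel_subset_ball (hC : SatisfiesCerami φ φ')
    (hφ : ∀ x, HasFDerivAt φ (φ' x) x) (hφ' : Continuous φ') {x₀ : X} (hx₀ : ∀ x, φ x₀ ≤ φ x)
    (huniq : ∀ x, φ x = φ x₀ → x = x₀) {r : ℝ} (hr : 0 < r) :
    ∃ η > 0, ∀ x, φ x < φ x₀ + η → ‖x - x₀‖ < r := by
  by_contra! hne
  have hφc : Continuous φ := continuous_iff_continuousAt.2 fun x => (hφ x).continuousAt
  obtain ⟨w, hw, -, hwr⟩ := hC.exists_critical_point hφ hφ' hx₀ (c := φ x₀)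
    (d := fun x => r / 2 - ‖x - x₀‖) (by fun_prop) fun ε hε => by
      obtain ⟨x, hx, hxr⟩ := hne (min ε (ε * (r / 2))) (by positivity)
      obtain ⟨v, hv1, hv⟩ := exists_ekeland hφc hx₀ hε x
      have h0 : 0 ≤ ε * dist x v := by positivity
      have h1 := min_le_left ε (ε * (r / 2))
      have h2 := min_le_right ε (ε * (r / 2))
      have h3 := hx₀ v
      refine ⟨v, ?_, (hφ v).norm_le_of_eventually_le hε.le (Eventually.of_forall hv), ?_⟩
      · rw [abs_of_nonneg (by linarith)]
        linarith
      · have h4 : dist x v ≤ r / 2 := le_of_mul_le_mul_left (by linarith) hε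
        rw [dist_eq_norm] at h4
        have h5 := norm_sub_le_norm_sub_add_norm_sub x v x₀
        linarith
  rw [huniq w hw, sub_self, norm_zero] at hwr
  linarith

end SatisfiesCerami

theorem ContinuousMap.homotopic_of_mem {S X : Type*} [TopologicalSpace S] [TopologicalSpace X]
    {A : Set X} (f g : C(S, A)) (H : C(unitInterval × S, X)) (hA : ∀ z, H z ∈ A)
    (h0 : ∀ y, H (0, y) = f y) (h1 : ∀ y, H (1, y) = g y) : f.Homotopic g :=
  ⟨{ toFun := fun z => ⟨H z, hA z⟩
     continuous_toFun := H.continuous.subtype_mk _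
     map_zero_left := fun y => Subtype.ext (h0 y)
     map_one_left := fun y => Subtype.ext (h1 y) }⟩

/-- If the minimizer `x₀` is the only critical point at a negative level, then compact families in
`{φ ≤ 0}` without critical points at level zero contract to `x₀` through points where `φ < 0`. -/
theorem SatisfiesCerami.exists_contraction_to_minimizer {X S : Type*} [NormedAddCommGroup X]
    [NormedSpace ℝ X] [CompleteSpace X] [TopologicalSpace S] [CompactSpace S] [T2Space S]
    {φ : X → ℝ} {φ' : X → X →L[ℝ] ℝ} (hC : SatisfiesCerami φ φ')
    (hφ : ∀ x, HasFDerivAt φ (φ' x) x) (hφ' : Continuous φ') {x₀ : X} (hx₀ : ∀ x, φ x₀ ≤ φ x)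
    (hneg : φ x₀ < 0) (hcrit : ∀ w, φ w < 0 → φ' w = 0 → w = x₀) (j : C(S, X))
    (hj : ∀ y, φ (j y) ≤ 0) (hjc : ∀ y, φ' (j y) ≠ 0) :
    ∃ K : C(unitInterval × S, X), (∀ y, K (0, y) = j y) ∧ (∀ y, K (1, y) = x₀) ∧
      ∀ z, φ (K z) < 0 ∨ K z ∈ range j := by
  rcases isEmpty_or_nonempty S with hS | hS
  · exact ⟨ContinuousMap.const _ x₀, fun y => hS.elim y, fun y => hS.elim y, fun z => hS.elim z.2⟩
  have hφc : Continuous φ := continuous_iff_continuousAt.2 fun x => (hφ x).continuousAt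
  let A : Set X := {x | φ x < 0 ∨ x ∈ range j}
  suffices h : ContinuousMap.Homotopic (⟨fun y => ⟨j y, Or.inr (mem_range_self y)⟩,
      j.continuous.subtype_mk _⟩ : C(S, A)) (ContinuousMap.const _ ⟨x₀, Or.inl hneg⟩) by
    obtain ⟨F⟩ := h
    refine ⟨⟨fun z => F z, continuous_subtype_val.comp F.continuous⟩, fun y => ?_, fun y => ?_,
      fun z => (F z).2⟩
    · simp
    · simp
  have hne : (univ : Set S).Nonempty := univ_nonempty
  obtain ⟨ε, hε, hεj⟩ : ∃ ε > 0, ∀ y, ε < ‖φ' (j y)‖ := by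
    obtain ⟨y₀, -, hy₀⟩ := isCompact_univ.exists_isMinOn hne
      (hφ'.comp j.continuous).norm.continuousOn
    have h0 := norm_pos_iff.2 (hjc y₀)
    refine ⟨‖φ' (j y₀)‖ / 2, by positivity, fun y => ?_⟩
    have : ‖φ' (j y₀)‖ ≤ ‖φ' (j y)‖ := hy₀ (mem_univ y)
    linarith
  obtain ⟨χ, w, σ, -, hχ, -, -, hσ, hdesc⟩ := exists_descent_direction hφ hφ' j isClosed_univ
    isClosed_empty (disjoint_empty univ) fun y _ => hεj y
  have hdesc' : ∀ s ∈ Icc 0 σ, ∀ y, φ (j y - s • w y) ≤ - (ε * s) := by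
    intro s hs y
    have := hdesc s hs y
    rw [hχ y (mem_univ y), mul_one] at this
    linarith [hj y]
  let j₁ : C(S, X) := ⟨fun y => j y - σ • w y, by fun_prop⟩
  set b := -(ε * σ)
  have hb : b < 0 := neg_neg_of_pos (mul_pos hε hσ)
  have hj₁ : ∀ y, φ (j₁ y) ≤ b := hdesc' σ ⟨hσ.le, le_rfl⟩
  let J₁ : C(S, A) := ⟨fun y => ⟨j₁ y, Or.inl ((hj₁ y).trans_lt hb)⟩, j₁.continuous.subtype_mk _⟩
  have hom₁ : ContinuousMap.Homotopic (⟨fun y => ⟨j y, Or.inr (mem_range_self y)⟩,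
      j.continuous.subtype_mk _⟩ : C(S, A)) J₁ := by
    refine ContinuousMap.homotopic_of_mem _ _
      ⟨fun z => j z.2 - ((z.1 : ℝ) * σ) • w z.2, by fun_prop⟩ (fun z => ?_)
      (fun y => by simp) (fun y => by simp [J₁, j₁])
    rcases z.1.2.1.eq_or_lt with h | h
    · exact Or.inr ⟨z.2, by simp [← h]⟩
    · refine Or.inl ((hdesc' (z.1 * σ) ⟨by positivity, ?_⟩ z.2).trans_lt ?_)
      · exact mul_le_of_le_one_left hσ.le z.1.2.2
      · exact neg_neg_of_pos (by positivity)
  let Λ : Set ℝ := {c | ∃ H : C(unitInterval × S, X), (∀ y, H (0, y) = j₁ y) ∧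
    (∀ z, φ (H z) ≤ b) ∧ ∀ y, φ (H (1, y)) ≤ c}
  have hΛne : Λ.Nonempty := ⟨b, ⟨fun z => j₁ z.2, by fun_prop⟩, fun y => rfl, fun z => hj₁ z.2,
    fun y => hj₁ y⟩
  have hΛbd : BddBelow Λ := ⟨φ x₀, by
    rintro c ⟨H, -, -, h⟩
    exact (hx₀ _).trans (h hS.some)⟩
  have hΛb : sInf Λ ≤ b := csInf_le hΛbd ⟨⟨fun z => j₁ z.2, by fun_prop⟩, fun y => rfl,
    fun z => hj₁ z.2, fun y => hj₁ y⟩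
  obtain ⟨u, hu, hu', -⟩ := hC.exists_critical_point hφ hφ' hx₀ (continuous_const (y := (0 : ℝ)))
    (c := sInf Λ) fun ε' hε' => by
      obtain ⟨c, ⟨H, hH0, hHb, hHc⟩, hc⟩ := exists_lt_of_csInf_lt hΛne
        (lt_add_of_pos_right (sInf Λ) hε')
      have hcl : ∀ t : unitInterval, IsClosed {z : unitInterval × S | z.1 = t} := fun t =>
        isClosed_eq continuous_fst continuous_const
      obtain ⟨f, hfB, hfb, hfc, z, hzE, hzmax, hz⟩ := exists_deformed_max_almost_critical hφ hφ' H
        (hcl 1) ⟨(1, hS.some), rfl⟩ (hcl 0) hε' (p := fun _ => 0) continuous_const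
        (fun x y => by positivity) (by simpa using hx₀) hHb
      simp only [add_zero] at hfc hzmax
      have h1 : φ (f z) ≤ c := hfc c (fun z' hz' => by
        have := hHc z'.2
        rwa [← show z'.1 = 1 from hz'] at this) z hzE
      have h2 : sInf Λ ≤ φ (f z) := csInf_le hΛbd
        ⟨f, fun y => (hfB _ rfl).trans (hH0 y), hfb, fun y => hzmax _ rfl⟩
      refine ⟨f z, ?_, hz.resolve_left fun h => ?_, hε'.le⟩
      · rw [abs_of_nonneg (by linarith)]
        linarith
      · exact zero_ne_one ((show z.1 = 0 from h).symm.trans hzE)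
  have hux₀ := hcrit u (by linarith) hu'
  rw [hux₀] at hu
  obtain ⟨r, hr, hball⟩ := Metric.mem_nhds_iff.1 (hφc.continuousAt.eventually (gt_mem_nhds hneg))
  obtain ⟨η, hη, hηr⟩ := hC.exists_sublevel_subset_ball hφ hφ' hx₀ (fun x hx => by
    refine hcrit x (hx ▸ hneg) (IsLocalMin.hasFDerivAt_eq_zero ?_ (hφ x))
    exact Eventually.of_forall fun y => hx ▸ hx₀ y) hr
  obtain ⟨c, ⟨H, hH0, hHb, hHc⟩, hc⟩ := exists_lt_of_csInf_lt hΛne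
    (lt_add_of_pos_right (sInf Λ) hη)
  have hmem : ∀ y, H (1, y) ∈ ball x₀ r := fun y => by
    rw [mem_ball_iff_norm]
    exact hηr _ (by linarith [hHc y])
  let J₂ : C(S, A) := ⟨fun y => ⟨H (1, y), Or.inl ((hHb _).trans_lt hb)⟩,
    Continuous.subtype_mk (by fun_prop) _⟩
  have hom₂ : J₁.Homotopic J₂ := ContinuousMap.homotopic_of_mem _ _ H
    (fun z => Or.inl ((hHb z).trans_lt hb)) hH0 fun y => rfl
  refine hom₁.trans (hom₂.trans ?_)
  refine ContinuousMap.homotopic_of_mem _ _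
    ⟨fun z => (1 - (z.1 : ℝ)) • H (1, z.2) + (z.1 : ℝ) • x₀, by fun_prop⟩ (fun z => Or.inl ?_)
    (fun y => by simp [J₂]) (fun y => by simp)
  exact hball (convex_ball x₀ r (hmem z.2) (mem_ball_self hr) (by linarith [z.1.2.2]) z.1.2.1
    (by ring))

/-- A homotopy defined on the unit sphere extends positively homogeneously to the whole space. -/
theorem exists_homogeneous_extension {X Y : Type*} [NormedAddCommGroup X] [NormedSpace ℝ X]
    [NormedAddCommGroup Y] [NormedSpace ℝ Y] [FiniteDimensional ℝ Y]
    (K : C(unitInterval × sphere (0 : Y) 1, X)) :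
    ∃ k : C(unitInterval × Y, X), (∀ t (c : ℝ) y, 0 ≤ c → k (t, c • y) = c • k (t, y)) ∧
      ∀ t (y : sphere (0 : Y) 1), k (t, y) = K (t, y) := by
  classical
  have : ProperSpace Y := FiniteDimensional.proper ℝ Y
  have hmem : ∀ y : Y, y ≠ 0 → ‖y‖⁻¹ • y ∈ sphere (0 : Y) 1 := fun y hy => by
    rw [mem_sphere_zero_iff_norm, norm_smul, norm_inv, norm_norm, inv_mul_cancel₀ (by simpa)]
  let k : unitInterval × Y → X := fun z =>
    if h : z.2 = 0 then 0 else ‖z.2‖ • K (z.1, ⟨‖z.2‖⁻¹ • z.2, hmem _ h⟩)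
  obtain ⟨C, hC⟩ : ∃ C, ∀ z, ‖K z‖ ≤ C := by
    obtain ⟨C, hC⟩ := (isCompact_range K.continuous).isBounded.exists_norm_le
    exact ⟨C, fun z => hC _ (mem_range_self z)⟩
  have hkC : ∀ z, ‖k z‖ ≤ ‖z.2‖ * C := fun z => by
    by_cases h : z.2 = 0
    · simp [k, h]
    · simp only [k, h, dite_false, norm_smul, norm_norm]
      gcongr
      exact hC _
  have hk : Continuous k := by
    refine continuous_iff_continuousAt.2 fun z => ?_
    by_cases h : z.2 = 0
    · have h1 : k z = 0 := by simp [k, h]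
      rw [ContinuousAt, h1]
      have hc : Continuous fun z : unitInterval × Y => ‖z.2‖ * C := by fun_prop
      exact squeeze_zero_norm hkC (by simpa [h] using hc.tendsto z)
    · have hU : IsOpen {z : unitInterval × Y | z.2 ≠ 0} := isOpen_ne_fun continuous_snd
        continuous_const
      refine ContinuousOn.continuousAt ?_ (hU.mem_nhds h)
      rw [continuousOn_iff_continuous_domRestrict]
      have hsnd : Continuous fun z : {z : unitInterval × Y | z.2 ≠ 0} => (z : unitInterval × Y).2 :=
        continuous_snd.comp continuous_subtype_val
      have hfst : Continuous fun z : {z : unitInterval × Y | z.2 ≠ 0} => (z : unitInterval × Y).1 :=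
        continuous_fst.comp continuous_subtype_val
      have hc : Continuous fun z : {z : unitInterval × Y | z.2 ≠ 0} =>
          ‖(z : unitInterval × Y).2‖ • K ((z : unitInterval × Y).1,
            ⟨‖(z : unitInterval × Y).2‖⁻¹ • (z : unitInterval × Y).2, hmem _ z.2⟩) :=
        hsnd.norm.smul (K.continuous.comp (hfst.prodMk (Continuous.subtype_mk
          ((hsnd.norm.inv₀ fun z => norm_ne_zero_iff.2 z.2).smul hsnd) _)))
      refine hc.congr fun z => ?_
      have hz : (z : unitInterval × Y).2 ≠ 0 := z.2
      simp [k, hz]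
  refine ⟨⟨k, hk⟩, fun t c y hc => ?_, fun t y => ?_⟩
  · simp only [ContinuousMap.coe_mk, k]
    by_cases hy : y = 0
    · simp [hy]
    rcases hc.eq_or_lt with rfl | hc
    · simp
    · have h1 : c • y ≠ 0 := smul_ne_zero hc.ne' hy
      have h2 : ‖c • y‖⁻¹ • c • y = ‖y‖⁻¹ • y := by
        rw [norm_smul, Real.norm_of_nonneg hc.le, smul_smul]
        congr 1
        field_simp
      have h3 : ‖c • y‖ = c * ‖y‖ := by rw [norm_smul, Real.norm_of_nonneg hc.le]
      simp only [h1, hy, dite_false, h2]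
      exact (congrArg (· • _) h3).trans (mul_smul c ‖y‖ _)
  · have h1 : ‖(y : Y)‖ = 1 := mem_sphere_zero_iff_norm.1 y.2
    have h2 : (y : Y) ≠ 0 := norm_ne_zero_iff.1 (by simp [h1])
    simp [k, h2, h1]

/-- Under local linking, a functional with a negative minimum attained at `x₀` that satisfies the
Cerami condition has a critical point besides `0` and `x₀`. -/
theorem SatisfiesCerami.exists_critical_point_of_local_linking {X Y : Type*}
    [NormedAddCommGroup X] [NormedSpace ℝ X] [CompleteSpace X] [NormedAddCommGroup Y]
    [NormedSpace ℝ Y] [FiniteDimensional ℝ Y] (i : Y →L[ℝ] X) (P : X →L[ℝ] Y)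
    (hP : ∀ y, P (i y) = y) (hi : ∀ y, ‖i y‖ = ‖y‖) {φ : X → ℝ} {φ' : X → X →L[ℝ] ℝ}
    (hC : SatisfiesCerami φ φ') (hφ : ∀ x, HasFDerivAt φ (φ' x) x) (hφ' : Continuous φ')
    (hzero : φ 0 = 0) {x₀ : X} (hx₀ : ∀ x, φ x₀ ≤ φ x) (hneg : φ x₀ < 0) {ρ : ℝ} (hρ : 0 < ρ)
    (hρx₀ : ρ < ‖x₀‖) (hY : ∀ y, ‖y‖ ≤ ρ → φ (i y) ≤ 0)
    (hV : ∀ v, P v = 0 → ‖v‖ ≤ ρ → 0 ≤ φ v) :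
    ∃ w, φ' w = 0 ∧ w ≠ 0 ∧ w ≠ x₀ := by
  by_contra! hcrit
  have : ProperSpace Y := FiniteDimensional.proper ℝ Y
  have hφc : Continuous φ := continuous_iff_continuousAt.2 fun x => (hφ x).continuousAt
  have hS : ∀ y : sphere (0 : Y) 1, ‖(y : Y)‖ = 1 := fun y => mem_sphere_zero_iff_norm.1 y.2
  let j : C(sphere (0 : Y) 1, X) := ⟨fun y => ρ • i y, by fun_prop⟩
  have hjn : ∀ y, ‖j y‖ = ρ := fun y => by
    simp [j, norm_smul, hi, hS, abs_of_pos hρ]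
  have hj : ∀ y, φ (ρ • i y) ≤ 0 ∨ 1 < ‖y‖ := fun y => by
    by_cases hy : ‖y‖ ≤ 1
    · left
      rw [← map_smul]
      refine hY _ ?_
      rw [norm_smul, Real.norm_of_nonneg hρ.le]
      exact mul_le_of_le_one_right hρ.le hy
    · exact Or.inr (not_le.1 hy)
  obtain ⟨K, hK0, hK1, hKA⟩ := hC.exists_contraction_to_minimizer hφ hφ' hx₀ hneg
    (fun w hw hw' => hcrit w hw' fun h => by rw [h, hzero] at hw; exact lt_irrefl _ hw) j
    (fun y => (hj y).resolve_right (by simp [hS]))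
    (fun y hy => by
      have h1 := hjn y
      rw [hcrit (j y) hy (norm_ne_zero_iff.1 (by rw [h1]; exact hρ.ne'))] at h1
      exact hρx₀.ne' h1)
  obtain ⟨k, hk, hkK⟩ := exists_homogeneous_extension K
  have hpolar : ∀ y : Y, y = 0 ∨ ∃ u : sphere (0 : Y) 1, y = ‖y‖ • (u : Y) := fun y => by
    by_cases hy : y = 0
    · exact Or.inl hy
    · have := norm_ne_zero_iff.2 hy
      refine Or.inr ⟨⟨‖y‖⁻¹ • y, ?_⟩, ?_⟩
      · rw [mem_sphere_zero_iff_norm, norm_smul, norm_inv, norm_norm, inv_mul_cancel₀ this]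
      · rw [smul_inv_smul₀ this]
  have hkz : ∀ t, k (t, 0) = 0 := fun t => by simpa using hk t 0 0 le_rfl
  have hk0 : ∀ y, k (0, y) = ρ • i y := fun y => by
    rcases hpolar y with rfl | ⟨u, hu⟩
    · simp [hkz]
    · rw [hu, hk _ _ _ (norm_nonneg y), hkK, hK0, map_smul, smul_comm]
      rfl
  have hk1 : ∀ y, k (1, y) = ‖y‖ • x₀ := fun y => by
    rcases hpolar y with rfl | ⟨u, hu⟩
    · simp [hkz]
    · conv_lhs => rw [hu, hk _ _ _ (norm_nonneg y), hkK, hK1]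
  have hkA : ∀ t (y : Y), ‖y‖ = 1 → φ (k (t, y)) < 0 ∨ ∃ u, k (t, y) = j u := fun t y hy => by
    have := hKA (t, ⟨y, mem_sphere_zero_iff_norm.2 hy⟩)
    rw [← hkK] at this
    exact this.imp id fun ⟨u, hu⟩ => ⟨u, hu.symm⟩
  have hkR : ∀ t y, ‖y‖ = 1 → P (k (t, y)) = 0 → ρ ≤ ‖k (t, y)‖ := fun t y hy h0 => by
    rcases hkA t y hy with h | ⟨u, hu⟩
    · by_contra! hlt
      exact absurd (hV _ h0 hlt.le) (not_le.2 h)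
    · rw [hu, hjn]
  let Z := unitInterval × closedBall (0 : Y) 1
  have hfst : Continuous fun z : Z => z.1 := continuous_fst
  have hsnd : Continuous fun z : Z => (z.2 : Y) := continuous_subtype_val.comp continuous_snd
  let f₀ : C(Z, X) := ⟨fun z => k (z.1, (z.2 : Y)) + ((1 - ‖(z.2 : Y)‖) * (z.1 : ℝ)) • x₀,
    (k.continuous.comp (hfst.prodMk hsnd)).add
      (((continuous_const.sub hsnd.norm).mul (continuous_subtype_val.comp hfst)).smul
        continuous_const)⟩
  let B : Set Z := {z | z.1 = 0 ∨ z.1 = 1 ∨ ‖(z.2 : Y)‖ = 1}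
  have hB : IsClosed B := (isClosed_eq hfst continuous_const).union
    ((isClosed_eq hfst continuous_const).union (isClosed_eq hsnd.norm continuous_const))
  have hf00 : ∀ y, f₀ (0, y) = ρ • i (y : Y) := fun y => by simp [f₀, hk0]
  have hf01 : ∀ y, f₀ (1, y) = x₀ := fun y => by simp [f₀, hk1, ← add_smul]
  have hf0k : ∀ t (y : closedBall (0 : Y) 1), ‖(y : Y)‖ = 1 → f₀ (t, y) = k (t, y) :=
    fun t y hy => by simp [f₀, hy]
  have hf0B : ∀ z ∈ B, φ (f₀ z) ≤ 0 := by
    rintro ⟨t, y⟩ (h | h | h)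
    · obtain rfl : t = 0 := h
      rw [hf00]
      exact (hj y).resolve_right (not_lt.2 (mem_closedBall_zero_iff.1 y.2))
    · obtain rfl : t = 1 := h
      rw [hf01]
      exact hneg.le
    · rw [hf0k t y h]
      rcases hkA t y h with h | ⟨u, hu⟩
      · exact h.le
      · rw [hu]
        exact (hj u).resolve_right (by simp [hS])
  let F : Set X := {x | P x = 0 ∧ ‖x‖ = ρ / 2}
  have hF : IsClosed F := (isClosed_eq P.continuous continuous_const).inter
    (isClosed_eq continuous_norm continuous_const)
  have hφF : ∀ x ∈ F, 0 ≤ φ x := fun x hx => hV x hx.1 (by rw [hx.2]; linarith)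
  have hlink : ∀ f : C(Z, X), (∀ z ∈ B, f z = f₀ z) → ∃ z, f z ∈ F := fun f hf =>
    exists_mem_ker_norm_eq_of_filling i P hP hρ (half_pos hρ) (half_lt_self hρ) x₀
      (fun _ => hρx₀.le) k hk hk0 hk1 hkR f
      (fun y => (hf _ (Or.inl rfl)).trans (hf00 y))
      (fun y => (hf _ (Or.inr (Or.inl rfl))).trans (hf01 y))
      (fun t y hy => (hf _ (Or.inr (Or.inr hy))).trans (hf0k t y hy))
  have hFne : F.Nonempty := let ⟨z, hz⟩ := hlink f₀ fun _ _ => rfl; ⟨_, hz⟩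
  have hf0F : ∀ z ∈ B, f₀ z ∉ F := by
    rintro ⟨t, y⟩ (h | h | h) ⟨h1, h2⟩
    · obtain rfl : t = 0 := h
      rw [hf00] at h1 h2
      rw [map_smul, hP, smul_eq_zero, or_iff_right hρ.ne'] at h1
      rw [h1, map_zero, smul_zero, norm_zero] at h2
      linarith
    · obtain rfl : t = 1 := h
      rw [hf01] at h2
      linarith
    · rw [hf0k t y h] at h1 h2
      have := hkR t y h h1
      linarith
  obtain ⟨d, hd, hdB⟩ : ∃ d > 0, ∀ z ∈ B, d ≤ infDist (f₀ z) F := by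
    obtain ⟨z, hzB, hz⟩ := hB.isCompact.exists_isMinOn
      ⟨(0, ⟨0, mem_closedBall_self zero_le_one⟩), Or.inl rfl⟩
      ((continuous_infDist_pt F).comp f₀.continuous).continuousOn
    exact ⟨_, (hF.notMem_iff_infDist_pos hFne).1 (hf0F z hzB), fun z' hz' => hz hz'⟩
  have hne : (univ : Set Z).Nonempty := ⟨(0, ⟨0, mem_closedBall_self zero_le_one⟩), mem_univ _⟩
  let Λ : Set ℝ := {c | ∃ f : C(Z, X), (∀ z ∈ B, f z = f₀ z) ∧ ∀ z, φ (f z) ≤ c}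
  have hΛ0 : ∀ c ∈ Λ, 0 ≤ c := by
    rintro c ⟨f, hfB, hfc⟩
    obtain ⟨z, hz⟩ := hlink f hfB
    exact (hφF _ hz).trans (hfc z)
  have hΛne : Λ.Nonempty := by
    obtain ⟨z, -, hz⟩ := isCompact_univ.exists_isMaxOn hne (hφc.comp f₀.continuous).continuousOn
    exact ⟨_, f₀, fun _ _ => rfl, fun z' => hz (mem_univ z')⟩
  have hΛbd : BddBelow Λ := ⟨0, hΛ0⟩
  rcases (le_csInf hΛne hΛ0).eq_or_lt with hc | hc
  · obtain ⟨w, hw, hw', hwF⟩ := hC.exists_critical_point hφ hφ' hx₀ (continuous_infDist_pt F)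
      (c := 0) fun ε₀ hε₀ => by
        obtain ⟨ε, hε, hεε₀, hε1, hεd⟩ : ∃ ε > 0, ε ≤ ε₀ ∧ ε ≤ 1 ∧ ε ≤ d :=
          ⟨min ε₀ (min 1 d), by positivity, min_le_left _ _,
            (min_le_right _ _).trans (min_le_left _ _), (min_le_right _ _).trans (min_le_right _ _)⟩
        have hε2 : 0 < ε ^ 2 / 8 := by positivity
        obtain ⟨c, ⟨f₁, hf₁B, hf₁c⟩, hcε⟩ := exists_lt_of_csInf_lt hΛne (hc ▸ hε2)
        let p : X → ℝ := fun u => ε / 4 * max 0 (ε - infDist u F)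
        have hpc : Continuous p := continuous_const.mul
          (continuous_const.max (continuous_const.sub (continuous_infDist_pt F)))
        have hp0 : ∀ u, 0 ≤ p u := fun u => mul_nonneg (by positivity) (le_max_left _ _)
        have hp : ∀ x y, p x ≤ p y + ε / 4 * ‖x - y‖ := fun x y => by
          have h1 : infDist y F ≤ infDist x F + dist y x := infDist_le_infDist_add_dist
          rw [dist_comm, dist_eq_norm] at h1
          have h2 : max 0 (ε - infDist x F) ≤ max 0 (ε - infDist y F) + ‖x - y‖ := by
            refine max_le (by positivity) ?_
            linarith [le_max_right 0 (ε - infDist y F)]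
          simp only [p]
          rw [← mul_add]
          gcongr
        obtain ⟨f, hfB, hfb, -, z, -, hzmax, hz⟩ := exists_deformed_max_almost_critical hφ hφ' f₁
          isClosed_univ hne hB hε (p := p) hpc hp (m := φ x₀)
          (fun x => by linarith [hx₀ x, hp0 x]) hf₁c
        have hfB' : ∀ z ∈ B, f z = f₀ z := fun z hz => (hfB z hz).trans (hf₁B z hz)
        obtain ⟨z', hz'⟩ := hlink f hfB'
        have hpz' : p (f z') = ε ^ 2 / 4 := by
          simp only [p, infDist_zero_of_mem hz', sub_zero, max_eq_right hε.le]
          ring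
        have h1 := hzmax z' (mem_univ _)
        rw [hpz'] at h1
        have h2 := hφF _ hz'
        have h3 := hfb z
        have h4 : infDist (f z) F < ε := by
          by_contra! hcon
          have : p (f z) = 0 := by simp [p, hcon]
          linarith
        have h5 : p (f z) ≤ ε ^ 2 / 4 := by
          have : max 0 (ε - infDist (f z) F) ≤ ε :=
            max_le hε.le (sub_le_self _ infDist_nonneg)
          calc p (f z) ≤ ε / 4 * ε := by simp only [p]; gcongr
            _ = ε ^ 2 / 4 := by ring
        refine ⟨f z, ?_, ?_, h4.le.trans hεε₀⟩
        · rw [sub_zero, abs_of_nonneg (by linarith)]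
          nlinarith
        · refine (hz.resolve_left fun hzB => ?_).trans hεε₀
          have := hdB z hzB
          rw [← hfB' z hzB] at this
          linarith
    have hwF' : w ∈ F := (hF.mem_iff_infDist_zero hFne).2 (le_antisymm hwF infDist_nonneg)
    have hw0 : w ≠ 0 := fun h => by
      have := hwF'.2
      rw [h, norm_zero] at this
      linarith
    rw [hcrit w hw' hw0] at hw
    linarith
  · obtain ⟨w, hw, hw', -⟩ := hC.exists_critical_point hφ hφ' hx₀ (continuous_const (y := (0 : ℝ)))
      (c := sInf Λ) fun ε hε => by
        obtain ⟨c, ⟨f₁, hf₁B, hf₁c⟩, hcε⟩ := exists_lt_of_csInf_lt hΛne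
          (lt_add_of_pos_right (sInf Λ) hε)
        obtain ⟨f, hfB, hfb, -, z, -, hzmax, hz⟩ := exists_deformed_max_almost_critical hφ hφ' f₁
          isClosed_univ hne hB hε (p := fun _ => 0) continuous_const (fun x y => by positivity)
          (by simpa using hx₀) hf₁c
        simp only [add_zero] at hzmax
        have hfB' : ∀ z ∈ B, f z = f₀ z := fun z hz => (hfB z hz).trans (hf₁B z hz)
        have h1 : sInf Λ ≤ φ (f z) := csInf_le hΛbd ⟨f, hfB', fun z' => hzmax z' (mem_univ _)⟩
        refine ⟨f z, ?_, hz.resolve_left fun hzB => ?_, hε.le⟩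
        · rw [abs_of_nonneg (by linarith)]
          linarith [hfb z]
        · have := hf0B z hzB
          rw [← hfB' z hzB] at this
          linarith
    have hw0 : w ≠ 0 := fun h => by
      rw [h, hzero] at hw
      linarith
    rw [hcrit w hw' hw0] at hw
    linarith

end

/-- **Local linking theorem (Brezis–Nirenberg).**
Let `X` be a real Banach space with a direct sum decomposition `X = Y ⊕ V` into closed
subspaces with `Y` finite dimensional. Let `φ : X → ℝ` be a `C¹` functional (with derivative
`φ'`) satisfying the Cerami condition, bounded below, with `φ 0 = 0` and `inf φ < 0`.
If there is `ρ > 0` with `φ ≤ 0` on the `ρ`-ball of `Y` and `φ ≥ 0` on the `ρ`-ball of `V`,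
then `φ` has at least two distinct nonzero critical points. -/
theorem local_linking_two_critical_points
    {X : Type*} [NormedAddCommGroup X] [NormedSpace ℝ X] [CompleteSpace X]
    (Y V : Submodule ℝ X)
    (hYclosed : IsClosed (Y : Set X)) (hVclosed : IsClosed (V : Set X))
    (hYfin : FiniteDimensional ℝ Y) (hcompl : IsCompl Y V)
    (φ : X → ℝ) (φ' : X → X →L[ℝ] ℝ)
    (hderiv : ∀ x, HasFDerivAt φ (φ' x) x) (hderivCont : Continuous φ')
    (hCerami : ∀ u : ℕ → X,
      (∃ C : ℝ, ∀ n, |φ (u n)| ≤ C) →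
      Filter.Tendsto (fun n => (1 + ‖u n‖) * ‖φ' (u n)‖) Filter.atTop (nhds 0) →
      ∃ (w : X) (σ : ℕ → ℕ), StrictMono σ ∧
        Filter.Tendsto (u ∘ σ) Filter.atTop (nhds w))
    (hbdd : BddBelow (Set.range φ))
    (hzero : φ 0 = 0)
    (hneg : ∃ x : X, φ x < 0)
    (hlink : ∃ ρ : ℝ, 0 < ρ ∧
      (∀ y : X, y ∈ Y → ‖y‖ ≤ ρ → φ y ≤ 0) ∧
      (∀ v : X, v ∈ V → ‖v‖ ≤ ρ → 0 ≤ φ v)) :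
    ∃ u₁ u₂ : X, u₁ ≠ u₂ ∧ u₁ ≠ 0 ∧ u₂ ≠ 0 ∧ φ' u₁ = 0 ∧ φ' u₂ = 0 := by
  obtain ⟨ρ, hρ, hY, hV⟩ := hlink
  have hC : SatisfiesCerami φ φ' := hCerami
  obtain ⟨x₀, hx₀', hx₀⟩ := hC.exists_isMinOn hderiv hderivCont hbdd
  obtain ⟨x, hx⟩ := hneg
  have hφx₀ : φ x₀ < 0 := (hx₀ x).trans_lt hx
  have hx₀0 : x₀ ≠ 0 := fun h => by
    rw [h, hzero] at hφx₀
    exact lt_irrefl _ hφx₀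
  have hn : 0 < ‖x₀‖ := norm_pos_iff.2 hx₀0
  have hT : Submodule.IsTopCompl Y V := Submodule.IsCompl.isTopCompl_of_isClosed hcompl hYclosed hVclosed
  obtain ⟨w, hw, hw0, hwx₀⟩ := hC.exists_critical_point_of_local_linking Y.subtypeL
    (Y.projectionOntoL V hT) (fun y => Submodule.projectionOntoL_apply_left hT y) (fun y => rfl)
    hderiv hderivCont hzero hx₀ hφx₀ (ρ := min ρ (‖x₀‖ / 2)) (lt_min hρ (half_pos hn))
    ((min_le_right _ _).trans_lt (half_lt_self hn))
    (fun y hy => hY y y.2 (hy.trans (min_le_left _ _)))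
    (fun v hv hvρ => hV v ((Submodule.projectionOntoL_apply_eq_zero_iff hT).1 hv)
      (hvρ.trans (min_le_left _ _)))
  exact ⟨x₀, w, hwx₀.symm, hx₀0, hw0, hx₀', hw⟩
end

section
/- Let E be a finite-dimensional real inner product space and let T : E → E be a continuous map for which there exists c > 0 such that ⟨T(u) − T(v), u − v⟩ ≥ c‖u − v‖² for all u, v ∈ E. Then T is bijective. -/
open RealInnerProductSpace

section

variable {E : Type*} [NormedAddCommGroup E] [InnerProductSpace ℝ E]

lemma sum_weighted_inner_nonneg_of_pairwise_monotone {ι : Type*} [Fintype ι]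
    (l : ι → ℝ) (a d : ι → E) (hl : ∀ i, 0 ≤ l i) (hpos : 0 < ∑ i, l i)
    (hd : ∑ i, l i • d i = 0) (hmono : ∀ i j, 0 ≤ ⟪a i - a j, d i - d j⟫) :
    0 ≤ ∑ i, l i * ⟪a i, d i⟫ := by
  have hnonneg : 0 ≤ ∑ i, ∑ j, l i * l j * ⟪a i - a j, d i - d j⟫ :=
    Finset.sum_nonneg fun i _ => Finset.sum_nonneg fun j _ =>
      mul_nonneg (mul_nonneg (hl i) (hl j)) (hmono i j)
  have hcross : ∑ i, ∑ j, l i * l j * ⟪a i, d j⟫ = 0 := by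
    refine Finset.sum_eq_zero fun i _ => ?_
    have h : ⟪a i, ∑ j, l j • d j⟫ = 0 := by rw [hd, inner_zero_right]
    simp only [inner_sum, real_inner_smul_right] at h
    simp only [mul_assoc, ← Finset.mul_sum, h, mul_zero]
  have hdiag : ∑ i, ∑ j, l i * l j * ⟪a i, d i⟫ = (∑ i, l i) * ∑ i, l i * ⟪a i, d i⟫ := by
    rw [mul_comm, Finset.sum_mul_sum]
    exact Finset.sum_congr rfl fun i _ => Finset.sum_congr rfl fun j _ => by ring
  have hexpand : ∑ i, ∑ j, l i * l j * ⟪a i - a j, d i - d j⟫ =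
      2 * ((∑ i, l i) * ∑ i, l i * ⟪a i, d i⟫) := by
    calc _ = ∑ i, ∑ j, (l i * l j * ⟪a i, d i⟫ + l j * l i * ⟪a j, d j⟫
          - l i * l j * ⟪a i, d j⟫ - l j * l i * ⟪a j, d i⟫) := by
          refine Finset.sum_congr rfl fun i _ => Finset.sum_congr rfl fun j _ => ?_
          simp only [inner_sub_left, inner_sub_right]
          ring
      _ = _ := by
          simp only [Finset.sum_sub_distrib, Finset.sum_add_distrib]
          rw [Finset.sum_comm (f := fun i j => l j * l i * ⟪a j, d j⟫),
            Finset.sum_comm (f := fun i j => l j * l i * ⟪a j, d i⟫), hcross, hdiag]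
          ring
  rw [hexpand] at hnonneg
  exact nonneg_of_mul_nonneg_right (by linarith) hpos

lemma concaveOn_inner_sub_norm_sq (w v : E) {c : ℝ} (hc : 0 ≤ c) :
    ConcaveOn ℝ Set.univ fun x : E => ⟪w, v - x⟫ - c * ‖v - x‖ ^ 2 := by
  refine ⟨convex_univ, fun x _ y _ a b ha hb hab => ?_⟩
  have hv : v - (a • x + b • y) = a • (v - x) + b • (v - y) := by
    obtain rfl : b = 1 - a := by linarith
    module
  have hsq : ‖a • (v - x) + b • (v - y)‖ ^ 2 =
      a * ‖v - x‖ ^ 2 + b * ‖v - y‖ ^ 2 - a * b * ‖(v - x) - (v - y)‖ ^ 2 := by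
    obtain rfl : b = 1 - a := by linarith
    simp only [← real_inner_self_eq_norm_sq, inner_add_left, inner_add_right, inner_sub_left,
      inner_sub_right, real_inner_smul_left, real_inner_smul_right, real_inner_comm x v,
      real_inner_comm y v, real_inner_comm x y]
    ring
  simp only [smul_eq_mul]
  rw [hv, hsq, inner_add_right, real_inner_smul_right, real_inner_smul_right]
  have := mul_nonneg hc (mul_nonneg (mul_nonneg ha hb) (sq_nonneg ‖(v - x) - (v - y)‖))
  linarith

/-- Approximate finite intersection property: finitely many relaxed variational inequalities for
strongly monotone data have a common solution. -/
lemma exists_forall_neg_lt_of_pairwise_strongly_monotone {ι : Type*} [Fintype ι]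
    (v w : ι → E) (ε : ι → ℝ) (hε : ∀ i, 0 < ε i) {c : ℝ} (hc : 0 ≤ c)
    (hmono : ∀ i j, c * ‖v i - v j‖ ^ 2 ≤ ⟪w i - w j, v i - v j⟫) :
    ∃ x, ∀ i, -ε i < ⟪w i, v i - x⟫ - c * ‖v i - x‖ ^ 2 := by
  classical
  set f : ι → E → ℝ := fun i x => ⟪w i, v i - x⟫ - c * ‖v i - x‖ ^ 2 with hf
  by_contra! hno
  let A : Set (ι → ℝ) := Set.univ.pi fun i => Set.Ioi (-ε i)
  let B : Set (ι → ℝ) := {t | ∃ x, ∀ i, t i ≤ f i x}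
  have hAconv : Convex ℝ A := convex_pi fun i _ => convex_Ioi _
  have hAopen : IsOpen A := isOpen_set_pi Set.finite_univ fun i _ => isOpen_Ioi
  have hBconv : Convex ℝ B := by
    rintro s ⟨x, hx⟩ t ⟨y, hy⟩ a b ha hb hab
    refine ⟨a • x + b • y, fun i => ?_⟩
    have h := (concaveOn_inner_sub_norm_sq (w i) (v i) hc).2 (Set.mem_univ x) (Set.mem_univ y)
      ha hb hab
    refine le_trans ?_ h
    simp only [Pi.add_apply, Pi.smul_apply, smul_eq_mul]
    exact add_le_add (mul_le_mul_of_nonneg_left (hx i) ha) (mul_le_mul_of_nonneg_left (hy i) hb)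
  have hdisj : Disjoint A B := by
    refine Set.disjoint_left.2 fun t htA ⟨x, hx⟩ => ?_
    obtain ⟨i, hi⟩ := hno x
    exact absurd (htA i (Set.mem_univ i)) (not_lt.2 ((hx i).trans hi))
  obtain ⟨L, u, hLA, hLB⟩ := geometric_hahn_banach_open hAconv hAopen hBconv hdisj
  have hu : 0 < u := by
    simpa using hLA 0 fun i _ => by simpa using hε i
  have hL : ∀ t, L t = -∑ i, -L (Pi.single i 1) * t i := by
    intro t
    conv_lhs => rw [pi_eq_sum_univ' t]
    simp [mul_comm]
  set l : ι → ℝ := fun i => -L (Pi.single i 1) with hldef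
  have hl : ∀ i, 0 ≤ l i := by
    intro i
    by_contra! hi
    have hμ : 0 < L (Pi.single i 1) := by simpa [hldef] using hi
    have h := hLA ((u / L (Pi.single i 1)) • Pi.single i 1) fun j _ => by
      have : 0 ≤ (u / L (Pi.single i 1)) * (Pi.single i (1 : ℝ) : ι → ℝ) j :=
        mul_nonneg (div_pos hu hμ).le (by by_cases h : j = i <;> simp [h])
      exact (neg_lt_zero.2 (hε j)).trans_le this
    rw [map_smul, smul_eq_mul, div_mul_cancel₀ _ hμ.ne'] at h
    exact lt_irrefl _ h
  have hBpos : ∀ x, ∑ i, l i * f i x < 0 := by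
    intro x
    have h := hLB (fun i => f i x) ⟨x, fun i => le_rfl⟩
    rw [hL] at h
    linarith
  have hsum : 0 < ∑ i, l i := by
    refine (Finset.sum_nonneg fun i _ => hl i).lt_of_ne fun h => ?_
    have h0 := (Finset.sum_eq_zero_iff_of_nonneg fun i _ => hl i).1 h.symm
    have h1 := hBpos 0
    rw [Finset.sum_eq_zero fun i hi => by rw [h0 i hi, zero_mul]] at h1
    exact lt_irrefl _ h1
  set x : E := (∑ i, l i)⁻¹ • ∑ i, l i • v i with hx
  have hbary : ∑ i, l i • (v i - x) = 0 := by
    simp only [smul_sub, Finset.sum_sub_distrib, ← Finset.sum_smul]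
    rw [hx, smul_inv_smul₀ hsum.ne', sub_self]
  have hnonneg := sum_weighted_inner_nonneg_of_pairwise_monotone l
    (fun i => w i - c • (v i - x)) (fun i => v i - x) hl hsum hbary fun i j => by
      have h1 : w i - c • (v i - x) - (w j - c • (v j - x)) =
          (w i - w j) - c • (v i - v j) := by module
      rw [h1, sub_sub_sub_cancel_right, inner_sub_left, real_inner_smul_left,
        real_inner_self_eq_norm_sq]
      linarith [hmono i j]
  refine (hBpos x).not_ge (hnonneg.trans_eq (Finset.sum_congr rfl fun i _ => ?_))
  rw [inner_sub_left, real_inner_smul_left, real_inner_self_eq_norm_sq]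

/-- Minty's lemma: a solution of the dual variational inequality for a continuous map is a
zero of that map. -/
lemma eq_zero_of_forall_inner_nonneg {F : E → E} (hF : Continuous F) {x : E}
    (h : ∀ v, 0 ≤ ⟪F v, v - x⟫) : F x = 0 := by
  have hpos : ∀ t : ℝ, 0 < t → 0 ≤ ⟪F (x - t • F x), -F x⟫ := by
    intro t ht
    have h1 := h (x - t • F x)
    rw [sub_sub_cancel_left, ← smul_neg, real_inner_smul_right] at h1
    exact nonneg_of_mul_nonneg_right h1 ht
  have hlim : Filter.Tendsto (fun t : ℝ => ⟪F (x - t • F x), -F x⟫) (nhdsWithin 0 (Set.Ioi 0))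
      (nhds ⟪F x, -F x⟫) := by
    have hcont : Continuous fun t : ℝ => ⟪F (x - t • F x), -F x⟫ := by fun_prop
    simpa using (hcont.tendsto 0).mono_left nhdsWithin_le_nhds
  have h0 := ge_of_tendsto hlim (eventually_nhdsWithin_of_forall hpos)
  rw [inner_neg_right] at h0
  exact real_inner_self_nonpos.1 (by linarith)

lemma injective_of_strongly_monotone {T : E → E} {c : ℝ} (hc : 0 < c)
    (hmono : ∀ u v : E, c * ‖u - v‖ ^ 2 ≤ ⟪T u - T v, u - v⟫) : Function.Injective T := by
  intro u v huv
  have h := hmono u v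
  rw [huv, sub_self, inner_zero_left] at h
  have h2 : ‖u - v‖ ^ 2 = 0 :=
    le_antisymm (nonpos_of_mul_nonpos_right h hc) (sq_nonneg _)
  exact sub_eq_zero.1 (norm_eq_zero.1 (pow_eq_zero_iff two_ne_zero |>.1 h2))

lemma isBounded_setOf_le_inner_sub_norm_sq (w v : E) {c : ℝ} (hc : 0 < c) (r : ℝ) :
    Bornology.IsBounded {x : E | r ≤ ⟪w, v - x⟫ - c * ‖v - x‖ ^ 2} := by
  refine (Metric.isBounded_closedBall (x := v) (r := (|r| + ‖w‖) / c + 1)).subset fun x hx => ?_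
  rw [Metric.mem_closedBall, dist_comm, dist_eq_norm]
  have h1 : r ≤ ⟪w, v - x⟫ - c * ‖v - x‖ ^ 2 := hx
  have h2 := real_inner_le_norm w (v - x)
  by_contra! hlt
  have hK : 0 ≤ (|r| + ‖w‖) / c := by positivity
  have hn : 1 < ‖v - x‖ := by linarith
  have h3 : |r| + ‖w‖ < c * ‖v - x‖ := by
    have := (div_lt_iff₀ hc).1 (show (|r| + ‖w‖) / c < ‖v - x‖ by linarith)
    linarith
  have h4 := mul_lt_mul_of_pos_right h3 (zero_lt_one.trans hn)
  have h5 := mul_le_mul_of_nonneg_left hn.le (abs_nonneg r)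
  linarith [neg_abs_le r]

lemma surjective_of_strongly_monotone_continuous [FiniteDimensional ℝ E] {T : E → E}
    (hT : Continuous T) {c : ℝ} (hc : 0 < c)
    (hmono : ∀ u v : E, c * ‖u - v‖ ^ 2 ≤ ⟪T u - T v, u - v⟫) : Function.Surjective T := by
  classical
  intro y
  let C : E × Set.Ioi (0 : ℝ) → Set E := fun p =>
    {x | -(p.2 : ℝ) ≤ ⟪T p.1 - y, p.1 - x⟫ - c * ‖p.1 - x‖ ^ 2}
  have hclosed : ∀ p, IsClosed (C p) := fun p =>
    isClosed_le continuous_const (by fun_prop)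
  let p₀ : E × Set.Ioi (0 : ℝ) := (0, ⟨1, Set.mem_Ioi.2 one_pos⟩)
  have hcompact : IsCompact (C p₀) := Metric.isCompact_of_isClosed_isBounded (hclosed p₀)
    (isBounded_setOf_le_inner_sub_norm_sq _ _ hc _)
  obtain ⟨x, -, hx⟩ := hcompact.inter_iInter_nonempty C hclosed fun s => by
    obtain ⟨x, hx⟩ := exists_forall_neg_lt_of_pairwise_strongly_monotone
      (ι := (insert p₀ s : Finset _)) (fun p => p.1.1) (fun p => T p.1.1 - y) (fun p => p.1.2)
      (fun p => p.1.2.2) hc.le fun i j => by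
        rw [sub_sub_sub_cancel_right]
        exact hmono _ _
    refine ⟨x, (hx ⟨p₀, Finset.mem_insert_self _ _⟩).le, Set.mem_iInter₂.2 fun p hp => ?_⟩
    exact (hx ⟨p, Finset.mem_insert_of_mem hp⟩).le
  refine ⟨x, sub_eq_zero.1 (eq_zero_of_forall_inner_nonneg (F := fun v => T v - y)
    (hT.sub continuous_const) fun v => ?_)⟩
  refine le_of_forall_pos_le_add fun ε hε => ?_
  have h : -ε ≤ ⟪T v - y, v - x⟫ - c * ‖v - x‖ ^ 2 := Set.mem_iInter.1 hx (v, ⟨ε, hε⟩)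
  have : 0 ≤ c * ‖v - x‖ ^ 2 := by positivity
  linarith

end

/-- A continuous strongly monotone map `T` on a finite-dimensional real inner product
space is bijective. -/
theorem bijective_of_strongly_monotone_continuous
    {E : Type*} [NormedAddCommGroup E] [InnerProductSpace ℝ E]
    [FiniteDimensional ℝ E]
    (T : E → E) (hT : Continuous T)
    (c : ℝ) (hc : 0 < c)
    (hmono : ∀ u v : E, c * ‖u - v‖ ^ 2 ≤ ⟪T u - T v, u - v⟫) :
    Function.Bijective T :=
  ⟨injective_of_strongly_monotone hc hmono, surjective_of_strongly_monotone_continuous hT hc hmono⟩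
end

section
/- Let H be a real Hilbert space, Y ⊆ H a finite-dimensional subspace and V = Y^⊥ its orthogonal complement, so that H = Y ⊕ V. Let φ : H → ℝ be a C¹ functional such that there exists c > 0 with ⟨φ'(v + y) − φ'(v + y'), y − y'⟩ ≤ −c‖y − y'‖² for all v ∈ V and all y, y' ∈ Y, where φ'(u) acts on y − y' via the duality pairing. Then there exists a continuous map τ : V → Y such that φ(v + τ(v)) = max{ φ(v + y) : y ∈ Y } for all v ∈ V. -/
/-- A function whose derivative is strongly decreasing along the segment from `x` to `x + d`
lies below its tangent minus a quadratic term. -/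
theorem HasFDerivAt.le_add_sub_of_strongly_decreasing
    {E : Type*} [NormedAddCommGroup E] [NormedSpace ℝ E] {φ : E → ℝ} {φ' : E → E →L[ℝ] ℝ}
    (hderiv : ∀ x, HasFDerivAt φ (φ' x) x) {c : ℝ} {x d : E}
    (hmono : ∀ t : ℝ, (φ' (x + t • d) - φ' x) (t • d) ≤ -c * ‖t • d‖ ^ 2) :
    φ (x + d) ≤ φ x + φ' x d - c / 2 * ‖d‖ ^ 2 := by
  let h : ℝ → ℝ := fun t ↦ φ (x + t • d) - t * φ' x d + c / 2 * ‖d‖ ^ 2 * t ^ 2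
  have hh (t : ℝ) : HasDerivAt h (φ' (x + t • d) d - φ' x d + c * ‖d‖ ^ 2 * t) t := by
    have hline : HasDerivAt (fun t : ℝ ↦ x + t • d) d t := by
      simpa using ((hasDerivAt_id t).smul_const d).const_add x
    refine ((((hderiv (x + t • d)).comp_hasDerivAt t hline).sub
      ((hasDerivAt_id t).mul_const (φ' x d))).add
      (((hasDerivAt_id t).pow 2).const_mul (c / 2 * ‖d‖ ^ 2))).congr_deriv ?_
    simp only [id_eq, Nat.cast_ofNat]
    ring
  have hanti : AntitoneOn h (Set.Ici 0) := by
    refine antitoneOn_of_deriv_nonpos (convex_Ici 0)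
      (fun t _ ↦ (hh t).continuousAt.continuousWithinAt)
      (fun t _ ↦ (hh t).differentiableAt.differentiableWithinAt) fun t ht ↦ ?_
    have ht : 0 < t := by simpa using ht
    rw [(hh t).deriv]
    have hm := hmono t
    simp only [map_smul, sub_apply, smul_eq_mul, norm_smul, mul_pow,
      Real.norm_eq_abs, sq_abs] at hm
    refine nonpos_of_mul_nonpos_right ?_ ht
    linarith
  have h01 := hanti (Set.mem_Ici.2 le_rfl) (Set.mem_Ici.2 zero_le_one) zero_le_one
  simp only [h, one_smul, zero_smul, add_zero] at h01
  linarith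

/-- **Reduction map.** Let `H` be a real Hilbert space, `Y` a finite-dimensional subspace
with orthogonal complement `V = Yᗮ`. Let `φ : H → ℝ` be `C¹` (with derivative `φ'`) such
that for some `c > 0`,
`(φ'(v + y) - φ'(v + y'))(y - y') ≤ -c‖y - y'‖²` for all `v ∈ V` and `y, y' ∈ Y`.
Then there is a continuous map `τ : V → Y` with
`φ(v + τ(v)) = max { φ(v + y) : y ∈ Y }` for every `v ∈ V`. -/
theorem exists_continuous_reduction_map
    {H : Type*} [NormedAddCommGroup H] [InnerProductSpace ℝ H] [CompleteSpace H]
    (Y : Submodule ℝ H) [FiniteDimensional ℝ Y]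
    (φ : H → ℝ) (φ' : H → H →L[ℝ] ℝ)
    (hderiv : ∀ x, HasFDerivAt φ (φ' x) x) (hderivCont : Continuous φ')
    (c : ℝ) (hc : 0 < c)
    (hmono : ∀ v : Yᗮ, ∀ y y' : Y,
      (φ' ((v : H) + y) - φ' ((v : H) + y')) ((y : H) - (y' : H))
        ≤ -c * ‖(y : H) - (y' : H)‖ ^ 2) :
    ∃ τ : Yᗮ → Y, Continuous τ ∧
      ∀ v : Yᗮ, ∀ y : Y, φ ((v : H) + y) ≤ φ ((v : H) + τ v) := by
  have hφ : Continuous φ := continuous_iff_continuousAt.2 fun x ↦ (hderiv x).continuousAt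
  have hmax (v : Yᗮ) : ∃ y₀ : Y, ∀ y : Y, φ ((v : H) + y) ≤ φ ((v : H) + y₀) := by
    refine Continuous.exists_forall_ge' (f := fun y : Y ↦ φ ((v : H) + y)) (by fun_prop) 0 ?_
    filter_upwards [(tendsto_norm_cocompact_atTop (E := Y)).eventually_ge_atTop
      (2 * ‖φ' v‖ / c)] with y hy
    have hquad := HasFDerivAt.le_add_sub_of_strongly_decreasing hderiv (c := c)
      (x := (v : H)) (d := (y : H)) fun t ↦ by simpa using hmono v (t • y) 0
    have hop := (le_abs_self _).trans ((φ' v).le_opNorm (y : H))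
    rw [div_le_iff₀ hc] at hy
    have hy' : 2 * ‖φ' v‖ ≤ ‖(y : H)‖ * c := hy
    simp only [ZeroMemClass.coe_zero, add_zero]
    nlinarith [norm_nonneg (y : H)]
  choose τ hτ using hmax
  have hcrit (v : Yᗮ) (y : Y) : φ' ((v : H) + τ v) y = 0 := by
    have hd : HasFDerivAt (fun y : Y ↦ φ ((v : H) + y))
        ((φ' ((v : H) + τ v)).comp Y.subtypeL) (τ v) :=
      (hderiv _).comp (τ v) (Y.subtypeL.hasFDerivAt.const_add (v : H))
    have hloc : IsLocalMax (fun y : Y ↦ φ ((v : H) + y)) (τ v) :=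
      Filter.Eventually.of_forall (hτ v)
    exact DFunLike.congr_fun (hloc.hasFDerivAt_eq_zero hd) y
  have hdist (v w : Yᗮ) :
      dist (τ w) (τ v) ≤ ‖φ' ((w : H) + τ v) - φ' ((v : H) + τ v)‖ / c := by
    have hm := hmono w (τ w) (τ v)
    have hw := hcrit w (τ w - τ v)
    have hv := hcrit v (τ w - τ v)
    have hop := (le_abs_self _).trans
      ((φ' ((w : H) + τ v) - φ' ((v : H) + τ v)).le_opNorm ((τ w - τ v : Y) : H))
    rw [sub_apply, hv] at hop
    rw [sub_apply, ← Submodule.coe_sub, hw] at hm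
    rw [dist_eq_norm, le_div_iff₀ hc, Submodule.coe_norm]
    rcases (norm_nonneg ((τ w - τ v : Y) : H)).eq_or_lt with h0 | hpos
    · rw [← h0, zero_mul]
      exact norm_nonneg _
    · refine le_of_mul_le_mul_right ?_ hpos
      linarith
  refine ⟨τ, continuous_iff_continuousAt.2 fun v ↦ ?_, hτ⟩
  rw [ContinuousAt, tendsto_iff_dist_tendsto_zero]
  refine squeeze_zero (fun _ ↦ dist_nonneg) (hdist v) ?_
  have hcont : Continuous fun w : Yᗮ ↦ ‖φ' ((w : H) + τ v) - φ' ((v : H) + τ v)‖ / c := by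
    fun_prop
  simpa using hcont.tendsto v
end

section
/- Let H be a real Hilbert space, Y ⊆ H a finite-dimensional subspace and V = Y^⊥ its orthogonal complement. Let φ : H → ℝ be a C¹ functional and let τ : V → Y be a continuous map such that φ(v + τ(v)) ≥ φ(v + y) for all v ∈ V and all y ∈ Y. Then the reduced functional φ̃ : V → ℝ defined by φ̃(v) = φ(v + τ(v)) is C¹, and for every v ∈ V its derivative is given by φ̃'(v)h = φ'(v + τ(v))h for all h ∈ V (that is, φ̃'(v) is the restriction of φ'(v + τ(v)) to V). -/
/-- Let `H` be a real Hilbert space, `Y` a finite-dimensional subspace, `V = Yᗮ`.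
Let `φ : H → ℝ` be `C¹` (with derivative `φ'`) and `τ : V → Y` continuous with
`φ(v + τ(v)) ≥ φ(v + y)` for all `v ∈ V`, `y ∈ Y`. Then the reduced functional
`φ̃(v) = φ(v + τ(v))` is `C¹` on `V` and `φ̃'(v) h = φ'(v + τ(v)) h` for every `h ∈ V`,
i.e. `φ̃'(v)` is the restriction of `φ'(v + τ(v))` to `V`. -/
theorem reduced_functional_C1
    {H : Type*} [NormedAddCommGroup H] [InnerProductSpace ℝ H] [CompleteSpace H]
    (Y : Submodule ℝ H) [FiniteDimensional ℝ Y]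
    (φ : H → ℝ) (φ' : H → H →L[ℝ] ℝ)
    (hderiv : ∀ x, HasFDerivAt φ (φ' x) x) (hderivCont : Continuous φ')
    (τ : Yᗮ → Y) (hτ : Continuous τ)
    (hmax : ∀ v : Yᗮ, ∀ y : Y, φ ((v : H) + y) ≤ φ ((v : H) + τ v)) :
    (∀ v : Yᗮ, HasFDerivAt (fun w : Yᗮ => φ ((w : H) + τ w))
        ((φ' ((v : H) + τ v)).comp (Yᗮ.subtypeL)) v) ∧
      Continuous (fun v : Yᗮ => (φ' ((v : H) + τ v)).comp (Yᗮ.subtypeL)) := by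
  refine ⟨fun v => ?_, ?_⟩
  · have hstrict : HasStrictFDerivAt φ (φ' ((v : H) + τ v)) ((v : H) + τ v) :=
      hasStrictFDerivAt_of_hasFDerivAt_of_continuousAt (Filter.Eventually.of_forall hderiv)
        hderivCont.continuousAt
    -- The increment of `φ` in the direction of `V`, at any height `σ w` tending to `τ v`.
    have increment (σ : Yᗮ → Y) (hσ : Continuous σ) (hσv : σ v = τ v) :
        (fun w : Yᗮ => φ ((w : H) + σ w) - φ ((v : H) + σ w) - φ' ((v : H) + τ v) ((w : H) - v))
          =o[nhds v] fun w => w - v := by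
      have hlim : Filter.Tendsto (fun w : Yᗮ => ((w : H) + σ w, (v : H) + σ w)) (nhds v)
          (nhds ((v : H) + τ v, (v : H) + τ v)) := by
        rw [← hσv]
        exact Continuous.tendsto (by fun_prop) v
      have h := (hstrict.isLittleO.comp_tendsto hlim).norm_right
      refine Asymptotics.IsLittleO.of_norm_right ?_
      simpa [Function.comp_def] using h
    have hlower := increment (fun _ => τ v) continuous_const rfl
    have hupper := increment τ hτ rfl
    refine .of_isLittleO <|
      (Asymptotics.IsBigO.of_norm_le fun w => ?_).trans_isLittleO
        (hlower.norm_left.add hupper.norm_left)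
    have h₁ := hmax w (τ v)
    have h₂ := hmax v (τ w)
    simp only [Real.norm_eq_abs, ContinuousLinearMap.comp_apply,
      Submodule.subtypeL_apply, Submodule.coe_sub]
    grind
  · exact (hderivCont.comp (by fun_prop)).clm_comp continuous_const
end

section
/- Let f : ℝ → ℝ be continuous, define F(x) = ∫₀ˣ f(s) ds, and let λ ∈ ℝ. Assume that limsup_{x→±∞} 2F(x)/x² ≤ λ and that f(x)x − 2F(x) → +∞ as |x| → ∞. Then λx² − 2F(x) → +∞ as |x| → ∞. -/
open Filter Topology in
/-- One-sided comparison: if `C ≤ f x * x - 2 * F x` on `[M, ∞)` with `F' = f`, then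
`(2 * F x + C) / x ^ 2` is monotone there, so it is bounded by any upper bound `lam` of
`limsup 2 * F x / x ^ 2`. -/
theorem le_quadratic_sub_potential_of_le {f F : ℝ → ℝ} {lam C M : ℝ} (hM : 0 < M)
    (hderiv : ∀ x, HasDerivAt F (f x) x)
    (hC : ∀ x, M ≤ x → C ≤ f x * x - 2 * F x)
    (hlim : ∀ ε : ℝ, 0 < ε → ∀ᶠ x in atTop, 2 * F x / x ^ 2 ≤ lam + ε)
    {x : ℝ} (hx : M ≤ x) : C ≤ lam * x ^ 2 - 2 * F x := by
  have hd : ∀ y, 0 < y → HasDerivAt (fun y => (2 * F y + C) / y ^ 2)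
      (2 * (f y * y - 2 * F y - C) / y ^ 3) y := by
    intro y hy
    refine ((((hderiv y).const_mul 2).add_const C).div (hasDerivAt_pow 2 y)
      (pow_ne_zero 2 hy.ne')).congr_deriv ?_
    field_simp
    ring
  have hmono : MonotoneOn (fun y => (2 * F y + C) / y ^ 2) (Set.Ici M) := by
    refine monotoneOn_of_hasDerivWithinAt_nonneg (convex_Ici M)
      (fun y hy => (hd y (hM.trans_le hy)).continuousAt.continuousWithinAt)
      (fun y hy => (hd y (hM.trans_le (interior_subset hy))).hasDerivWithinAt) ?_
    intro y hy
    have hMy : M ≤ y := interior_subset hy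
    have hy0 : 0 < y := hM.trans_le hMy
    have := hC y hMy
    exact div_nonneg (by linarith) (by positivity)
  have hle : (2 * F x + C) / x ^ 2 ≤ lam := by
    refine le_of_forall_pos_le_add fun ε hε => ?_
    have hzero : Tendsto (fun y : ℝ => C / y ^ 2) atTop (𝓝 0) :=
      tendsto_const_nhds.div_atTop (tendsto_pow_atTop two_ne_zero)
    obtain ⟨y, hy₁, hy₂, hxy⟩ := ((hlim (ε / 2) (half_pos hε)).and
      ((hzero.eventually_lt_const (half_pos hε)).and (eventually_ge_atTop x))).exists
    have h := hmono hx (hx.trans hxy) hxy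
    simp only [add_div] at h ⊢
    linarith
  rw [div_le_iff₀ (pow_pos (hM.trans_le hx) 2)] at hle
  linarith


/-- Let `f : ℝ → ℝ` be continuous with primitive `F x = ∫ s in 0..x, f s`, and `λ ∈ ℝ`.
If `limsup_{|x|→∞} 2F(x)/x² ≤ λ` and `f(x)x - 2F(x) → +∞` as `|x| → ∞`,
then `λx² - 2F(x) → +∞` as `|x| → ∞`. -/
theorem quadratic_minus_potential_tendsto_atTop
    (f F : ℝ → ℝ) (hf : Continuous f)
    (hF : ∀ x : ℝ, F x = ∫ s in (0:ℝ)..x, f s)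
    (lam : ℝ)
    (hlimsup : ∀ ε : ℝ, 0 < ε → ∃ M : ℝ, 0 < M ∧
      ∀ x : ℝ, M ≤ |x| → 2 * F x / x ^ 2 ≤ lam + ε)
    (hinfty : ∀ C : ℝ, ∃ M : ℝ, 0 < M ∧
      ∀ x : ℝ, M ≤ |x| → C ≤ f x * x - 2 * F x) :
    ∀ C : ℝ, ∃ M : ℝ, 0 < M ∧
      ∀ x : ℝ, M ≤ |x| → C ≤ lam * x ^ 2 - 2 * F x := by
  have hderiv : ∀ x, HasDerivAt F (f x) x := by
    rw [funext hF]
    exact fun x => hf.integral_hasStrictDerivAt 0 x |>.hasDerivAt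
  intro C
  obtain ⟨M, hM, hC⟩ := hinfty C
  refine ⟨M, hM, fun x hx => ?_⟩
  rcases le_abs.mp hx with hx | hx
  · refine le_quadratic_sub_potential_of_le hM hderiv
      (fun y hy => hC y (hy.trans (le_abs_self y))) (fun ε hε => ?_) hx
    obtain ⟨N, -, hN⟩ := hlimsup ε hε
    filter_upwards [Filter.eventually_ge_atTop N] with y hy
    exact hN y (hy.trans (le_abs_self y))
  · have hreflect := le_quadratic_sub_potential_of_le (f := fun y => -f (-y))
      (F := fun y => F (-y)) (lam := lam) (C := C) hM
      (fun y => ((hderiv (-y)).comp y (hasDerivAt_neg y)).congr_deriv (mul_neg_one _))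
      (fun y hy => by
        have := hC (-y) (by rw [abs_neg]; exact hy.trans (le_abs_self y))
        linarith)
      (fun ε hε => by
        obtain ⟨N, -, hN⟩ := hlimsup ε hε
        filter_upwards [Filter.eventually_ge_atTop N] with y hy
        have := hN (-y) (by rw [abs_neg]; exact hy.trans (le_abs_self y))
        rwa [neg_sq] at this) hx
    simpa only [neg_neg, neg_sq] using hreflect
end

section
/- Let f : ℝ → ℝ be continuous, define F(x) = ∫₀ˣ f(s) ds, and let λ > 0 and M > 0 be such that f(x)x − 2F(x) ≥ λ for all x ≥ M. Then for all real numbers y ≥ v ≥ M one has F(y)/y² − F(v)/v² ≥ (λ/2)(1/v² − 1/y²). -/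
/-- Let `f : ℝ → ℝ` be continuous with primitive `F x = ∫ s in 0..x, f s`. If `λ > 0`,
`M > 0` and `f(x)x - 2F(x) ≥ λ` for all `x ≥ M`, then for all `y ≥ v ≥ M` we have
`F(y)/y² - F(v)/v² ≥ (λ/2)(1/v² - 1/y²)`. -/
theorem potential_quotient_inequality
    (f F : ℝ → ℝ) (hf : Continuous f)
    (hF : ∀ x : ℝ, F x = ∫ s in (0:ℝ)..x, f s)
    (lam M : ℝ) (hlam : 0 < lam) (hM : 0 < M)
    (hlb : ∀ x : ℝ, M ≤ x → lam ≤ f x * x - 2 * F x) :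
    ∀ v y : ℝ, M ≤ v → v ≤ y →
      lam / 2 * (1 / v ^ 2 - 1 / y ^ 2) ≤ F y / y ^ 2 - F v / v ^ 2 := by
  intro v y hv hvy
  have hFd (x : ℝ) : HasDerivAt F (f x) x := by
    rw [funext hF]
    exact hf.integral_hasStrictDerivAt 0 x |>.hasDerivAt
  have hGd (x : ℝ) (hx : M ≤ x) : HasDerivAt (fun x => (F x + lam / 2) / x ^ 2)
      ((f x * x - 2 * F x - lam) / x ^ 3) x := by
    have hx0 : x ≠ 0 := (hM.trans_le hx).ne'
    refine (((hFd x).add_const (lam / 2)).fun_div (hasDerivAt_pow 2 x)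
      (pow_ne_zero 2 hx0)).congr_deriv ?_
    field_simp
    ring
  have hmono : MonotoneOn (fun x => (F x + lam / 2) / x ^ 2) (Set.Ici M) := by
    refine monotoneOn_of_hasDerivWithinAt_nonneg (convex_Ici M)
      (fun x hx => (hGd x hx).continuousAt.continuousWithinAt)
      (fun x hx => (hGd x (interior_subset hx)).hasDerivWithinAt) fun x hx => ?_
    have hx : M ≤ x := interior_subset hx
    exact div_nonneg (sub_nonneg.2 (hlb x hx)) (pow_nonneg (hM.le.trans hx) 3)
  have h := hmono hv (hv.trans hvy) hvy
  simp only [add_div] at h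
  linear_combination h
end

section
/- Let f : ℝ → ℝ be continuous, define F(x) = ∫₀ˣ f(s) ds, and suppose there are constants a ≥ 0, ϑ ∈ ℝ and δ > 0 such that |f(x)| ≤ a(1 + |x|) for all x ∈ ℝ and f(x)x ≤ ϑx² for all |x| ≤ δ. Then for every r > 2 there exists c > 0 such that F(x) ≤ (ϑ/2)x² + c|x|^r for all x ∈ ℝ. -/
theorem integral_le_half_mul_sq_of_nonneg {f : ℝ → ℝ} (hf : Continuous f) {ϑ δ : ℝ}
    (hnear : ∀ x : ℝ, |x| ≤ δ → f x * x ≤ ϑ * x ^ 2) {x : ℝ} (hx : 0 ≤ x) (hxδ : x ≤ δ) :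
    ∫ s in (0 : ℝ)..x, f s ≤ ϑ / 2 * x ^ 2 := by
  calc ∫ s in (0 : ℝ)..x, f s ≤ ∫ s in (0 : ℝ)..x, ϑ * s := by
        refine intervalIntegral.integral_mono_on_of_le_Ioo hx (hf.intervalIntegrable _ _)
          ((continuous_const.mul continuous_id).intervalIntegrable _ _) fun s hs => ?_
        refine le_of_mul_le_mul_right ?_ hs.1
        have := hnear s (by rw [abs_of_pos hs.1]; exact hs.2.le.trans hxδ)
        linarith
    _ = ϑ / 2 * x ^ 2 := by
        rw [intervalIntegral.integral_const_mul, integral_id]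
        ring

theorem integral_le_half_mul_sq {f : ℝ → ℝ} (hf : Continuous f) {ϑ δ : ℝ}
    (hnear : ∀ x : ℝ, |x| ≤ δ → f x * x ≤ ϑ * x ^ 2) {x : ℝ} (hx : |x| ≤ δ) :
    ∫ s in (0 : ℝ)..x, f s ≤ ϑ / 2 * x ^ 2 := by
  rcases le_total 0 x with h | h
  · exact integral_le_half_mul_sq_of_nonneg hf hnear h ((le_abs_self x).trans hx)
  · have key := integral_le_half_mul_sq_of_nonneg (f := fun s => -f (-s)) (ϑ := ϑ) (δ := δ)
      (by fun_prop) (fun s hs => by have := hnear (-s) (by rwa [abs_neg]); linarith)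
      (neg_nonneg.2 h) ((neg_le_abs x).trans hx)
    rwa [intervalIntegral.integral_neg, intervalIntegral.integral_comp_neg, neg_neg, neg_zero,
      ← intervalIntegral.integral_symm, neg_sq] at key

theorem abs_integral_le_of_linear_growth {f : ℝ → ℝ} {a : ℝ} (ha : 0 ≤ a)
    (hgrowth : ∀ x : ℝ, |f x| ≤ a * (1 + |x|)) (x : ℝ) :
    |∫ s in (0 : ℝ)..x, f s| ≤ a * (1 + |x|) * |x| := by
  have key := intervalIntegral.norm_integral_le_of_norm_le_const (a := 0) (b := x) (f := f)
    (C := a * (1 + |x|)) fun s hs => by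
      have hsx : |s| ≤ |x| := by
        simpa using Set.abs_sub_left_of_mem_uIcc (Set.uIoc_subset_uIcc hs)
      exact (hgrowth s).trans (by gcongr)
  simpa using key


/-- Let `f : ℝ → ℝ` be continuous with primitive `F x = ∫ s in 0..x, f s`. Suppose
`|f x| ≤ a(1 + |x|)` for all `x` (with `a ≥ 0`) and `f(x)x ≤ ϑx²` for `|x| ≤ δ`
(with `δ > 0`). Then for every `r > 2` there is `c > 0` such that
`F x ≤ (ϑ/2)x² + c|x|^r` for all `x ∈ ℝ`. -/
theorem potential_upper_bound
    (f F : ℝ → ℝ) (hf : Continuous f)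
    (hF : ∀ x : ℝ, F x = ∫ s in (0:ℝ)..x, f s)
    (a ϑ δ : ℝ) (ha : 0 ≤ a) (hδ : 0 < δ)
    (hgrowth : ∀ x : ℝ, |f x| ≤ a * (1 + |x|))
    (hnear : ∀ x : ℝ, |x| ≤ δ → f x * x ≤ ϑ * x ^ 2) :
    ∀ r : ℝ, 2 < r → ∃ c : ℝ, 0 < c ∧
      ∀ x : ℝ, F x ≤ ϑ / 2 * x ^ 2 + c * |x| ^ r := by
  intro r hr
  have hC : 0 < a * (1 / δ + 1) + |ϑ| / 2 + 1 := by positivity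
  refine ⟨(a * (1 / δ + 1) + |ϑ| / 2 + 1) * δ ^ (2 - r), by positivity, fun x => ?_⟩
  rw [hF]
  rcases le_total |x| δ with h | h
  · have h₁ := integral_le_half_mul_sq hf hnear h
    have h₂ : 0 ≤ (a * (1 / δ + 1) + |ϑ| / 2 + 1) * δ ^ (2 - r) * |x| ^ r := by positivity
    linarith
  · have hx : 0 < |x| := hδ.trans_le h
    have h₁ := (le_abs_self _).trans (abs_integral_le_of_linear_growth ha hgrowth x)
    have h₂ : x ^ 2 ≤ δ ^ (2 - r) * |x| ^ r := by
      calc x ^ 2 = |x| ^ (2 - r) * |x| ^ r := by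
            rw [← Real.rpow_add hx, sub_add_cancel, Real.rpow_two, sq_abs]
        _ ≤ δ ^ (2 - r) * |x| ^ r := by
            gcongr ?_ * _
            exact Real.rpow_le_rpow_of_nonpos hδ h (by linarith)
    have h₃ : |x| ≤ 1 / δ * x ^ 2 := by
      rw [← sq_abs, one_div_mul_eq_div, le_div_iff₀ hδ]
      nlinarith
    have h₄ := mul_le_mul_of_nonneg_left h₂ hC.le
    have h₅ := mul_le_mul_of_nonneg_left h₃ ha
    have h₆ := mul_le_mul_of_nonneg_right (neg_abs_le ϑ) (sq_nonneg x)
    nlinarith [sq_abs x, sq_nonneg x]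
end

section
/- Let X be a real Banach space and let φ : X → ℝ be a C¹ functional that is bounded below and satisfies the Cerami condition. Then φ is coercive, that is, φ(u) → +∞ as ‖u‖ → ∞. -/
open Filter Topology in
/-- **Ekeland's variational principle.** A lower semicontinuous function `f` bounded below on a
complete metric space has, below any point `x`, a strict minimiser `v` of `f + δ * dist · v`. -/
theorem exists_ekeland_point {X : Type*} [MetricSpace X] [CompleteSpace X] {f : X → ℝ}
    (hf : LowerSemicontinuous f) (hbdd : BddBelow (Set.range f)) {δ : ℝ} (hδ : 0 < δ) (x : X) :
    ∃ v, f v + δ * dist v x ≤ f x ∧ ∀ w, w ≠ v → f v < f w + δ * dist w v := by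
  let T : X → Set X := fun y => {w | f w + δ * dist w y ≤ f y}
  have hT_self (y : X) : y ∈ T y := by simp [T]
  have hT_trans {y z w : X} (hz : z ∈ T y) (hw : w ∈ T z) : w ∈ T y := by
    have h := mul_le_mul_of_nonneg_left (dist_triangle w z y) hδ.le
    simp only [T, Set.mem_ofPred_eq] at *
    linarith
  have hT_le {y w : X} (hw : w ∈ T y) : f w ≤ f y := by
    have h := mul_nonneg hδ.le (dist_nonneg (x := w) (y := y))
    simp only [T, Set.mem_ofPred_eq] at hw
    linarith
  have hT_closed (y : X) : IsClosed (T y) :=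
    (hf.add (by fun_prop : Continuous fun w => δ * dist w y).lowerSemicontinuous).isClosed_preimage
      (f y)
  have hnext (n : ℕ) (y : X) : ∃ w ∈ T y, ∀ z ∈ T y, f w < f z + 1 / ((n : ℝ) + 1) := by
    have hpos : (0 : ℝ) < 1 / ((n : ℝ) + 1) := by positivity
    obtain ⟨_, ⟨w, hw, rfl⟩, hlt⟩ := exists_lt_of_csInf_lt
      (Set.Nonempty.image f ⟨y, hT_self y⟩)
      (lt_add_of_pos_right (sInf (f '' T y)) hpos)
    refine ⟨w, hw, fun z hz => hlt.trans_le ?_⟩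
    gcongr
    exact csInf_le (hbdd.mono (Set.image_subset_range f _)) ⟨z, hz, rfl⟩
  choose next hmem hmin using hnext
  let u : ℕ → X := fun n => Nat.rec x next n
  have hu {n m : ℕ} (h : n ≤ m) : u m ∈ T (u n) := by
    induction m, h using Nat.le_induction with
    | base => exact hT_self _
    | succ m _ ih => exact hT_trans ih (hmem m (u m))
  have hanti : Antitone (f ∘ u) := fun _ _ h => hT_le (hu h)
  have hbdd_u : BddBelow (Set.range (f ∘ u)) := hbdd.mono (Set.range_comp_subset_range u f)
  have hlim := tendsto_atTop_ciInf hanti hbdd_u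
  have hcauchy : CauchySeq u := by
    refine cauchySeq_of_le_tendsto_0' (fun n => ((f ∘ u) n - ⨅ i, (f ∘ u) i) / δ)
      (fun n m h => ?_) ?_
    · have hm : f (u m) + δ * dist (u m) (u n) ≤ f (u n) := hu h
      have hinf : ⨅ i, (f ∘ u) i ≤ f (u m) := ciInf_le hbdd_u m
      rw [dist_comm, le_div_iff₀ hδ, Function.comp_apply]
      linarith
    · simpa using (hlim.sub_const (⨅ i, (f ∘ u) i)).div_const δ
  obtain ⟨v, hv⟩ := cauchySeq_tendsto_of_complete hcauchy
  have hvT (n : ℕ) : v ∈ T (u n) :=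
    (hT_closed _).mem_of_tendsto hv (eventually_atTop.2 ⟨n, fun _ h => hu h⟩)
  refine ⟨v, hvT 0, fun w hne => ?_⟩
  by_contra! hw
  have hle : f v ≤ f w := by
    refine ge_of_tendsto' (by simpa using tendsto_one_div_add_atTop_nhds_zero_nat.const_add (f w))
      fun n => (hT_le (hvT (n + 1))).trans (hmin n (u n) w (hT_trans (hvT n) hw)).le
  have := mul_pos hδ (dist_pos.2 hne)
  linarith

open Filter Topology in
/-- If the decrease of `f` near `v` has slope at most `δ`, then its derivative at `v` has norm at
most `δ`. -/
theorem HasFDerivAt.norm_le_of_eventually_le_add {X : Type*} [NormedAddCommGroup X]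
    [NormedSpace ℝ X] {f : X → ℝ} {f' : X →L[ℝ] ℝ} {v : X} (hf : HasFDerivAt f f' v) {δ : ℝ}
    (hδ : 0 ≤ δ) (h : ∀ᶠ w in 𝓝 v, f v ≤ f w + δ * ‖w - v‖) : ‖f'‖ ≤ δ := by
  have key (y : X) : -(δ * ‖y‖) ≤ f' y := by
    have hline : HasDerivAt (fun t : ℝ => f (v + t • y)) (f' y) 0 := hf.hasLineDerivAt y
    refine ge_of_tendsto hline.tendsto_slope_zero_right ?_
    have hcont : Tendsto (fun t : ℝ => v + t • y) (𝓝[>] 0) (𝓝 v) := by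
      refine (Continuous.tendsto' (by fun_prop) 0 v (by simp)).mono_left nhdsWithin_le_nhds
    filter_upwards [hcont.eventually h, self_mem_nhdsWithin] with t ht htpos
    rw [Set.mem_Ioi] at htpos
    rw [add_sub_cancel_left, norm_smul, Real.norm_of_nonneg htpos.le] at ht
    simp only [zero_add, zero_smul, add_zero, smul_eq_mul]
    rw [inv_mul_eq_div, le_div_iff₀ htpos]
    linarith
  refine f'.opNorm_le_bound hδ fun y => abs_le.2 ⟨key y, ?_⟩
  have := key (-y)
  rw [map_neg, norm_neg] at this
  linarith

/-- If `f ≥ a` outside the ball of radius `r`, and `f x ≤ a + ε` with `‖x‖` large, then near `x`,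
at distance at most `‖x‖ / 2`, there is a point where `f` is almost critical. -/
theorem exists_norm_fderiv_le_of_le_add {X : Type*} [NormedAddCommGroup X] [NormedSpace ℝ X]
    [CompleteSpace X] {f : X → ℝ} {f' : X → X →L[ℝ] ℝ} (hf : ∀ x, HasFDerivAt f (f' x) x)
    {a r ε : ℝ} (ha : ∀ u, r ≤ ‖u‖ → a ≤ f u) (hε : 0 < ε) {x : X} (hx0 : 0 < ‖x‖)
    (hx : 2 * r < ‖x‖) (hfx : f x ≤ a + ε) :
    ∃ v, ‖v - x‖ ≤ ‖x‖ / 2 ∧ f v ≤ f x ∧ ‖f' v‖ ≤ 2 * ε / ‖x‖ := by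
  have hcont : Continuous f := continuous_iff_continuousAt.2 fun x => (hf x).continuousAt
  let S : Set X := {u | r ≤ ‖u‖}
  have hS : IsClosed S := isClosed_le continuous_const continuous_norm
  have : CompleteSpace S := hS.completeSpace_coe
  have hδ : 0 < 2 * ε / ‖x‖ := by positivity
  obtain ⟨⟨v, hvS⟩, hvx, hmin⟩ := exists_ekeland_point (f := fun u : S => f u)
    (hcont.comp continuous_subtype_val).lowerSemicontinuous
    ⟨a, by rintro _ ⟨u, rfl⟩; exact ha u u.2⟩ hδ ⟨x, by simp only [S, Set.mem_ofPred_eq]; linarith⟩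
  simp only [Subtype.dist_eq, dist_eq_norm] at hvx hmin
  have hav := ha v hvS
  have hdist : ‖v - x‖ ≤ ‖x‖ / 2 := by
    have h : 2 * ε / ‖x‖ * ‖v - x‖ ≤ 2 * ε / ‖x‖ * (‖x‖ / 2) := by
      have : 2 * ε / ‖x‖ * (‖x‖ / 2) = ε := by field_simp
      linarith
    exact le_of_mul_le_mul_left h hδ
  have hrv : r < ‖v‖ := by
    have := norm_sub_norm_le x v
    rw [norm_sub_rev] at this
    linarith
  refine ⟨v, hdist, ?_, (hf v).norm_le_of_eventually_le_add hδ.le ?_⟩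
  · have := mul_nonneg hδ.le (norm_nonneg (v - x))
    linarith
  · filter_upwards [continuous_norm.continuousAt.eventually_const_lt hrv] with w hw
    rcases eq_or_ne w v with rfl | hne
    · simp
    · exact (hmin ⟨w, hw.le⟩ (by simpa using hne)).le

/-- A `C¹` functional on a real Banach space that is bounded below and satisfies the
Cerami condition is coercive: `φ(u) → +∞` as `‖u‖ → ∞`. -/
theorem coercive_of_bddBelow_cerami
    {X : Type*} [NormedAddCommGroup X] [NormedSpace ℝ X] [CompleteSpace X]
    (φ : X → ℝ) (φ' : X → X →L[ℝ] ℝ)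
    (hderiv : ∀ x, HasFDerivAt φ (φ' x) x) (hderivCont : Continuous φ')
    (hbdd : BddBelow (Set.range φ))
    (hCerami : ∀ u : ℕ → X,
      (∃ C : ℝ, ∀ n, |φ (u n)| ≤ C) →
      Filter.Tendsto (fun n => (1 + ‖u n‖) * ‖φ' (u n)‖) Filter.atTop (nhds 0) →
      ∃ (w : X) (σ : ℕ → ℕ), StrictMono σ ∧
        Filter.Tendsto (u ∘ σ) Filter.atTop (nhds w)) :
    ∀ M : ℝ, ∃ R : ℝ, 0 < R ∧ ∀ u : X, R ≤ ‖u‖ → M ≤ φ u := by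
  intro M
  by_contra! hM
  let A : Set ℝ := {a | ∃ r, ∀ u, r ≤ ‖u‖ → a ≤ φ u}
  obtain ⟨b, hb⟩ := hbdd
  have hb (u : X) : b ≤ φ u := hb ⟨u, rfl⟩
  have hA_ne : A.Nonempty := ⟨b, 0, fun u _ => hb u⟩
  have hA_bdd : BddAbove A := by
    refine ⟨M, fun a ⟨r, hr⟩ => ?_⟩
    obtain ⟨u, hu, hlt⟩ := hM (max r 1) (by positivity)
    exact (hr u ((le_max_left _ _).trans hu)).trans hlt.le
  have key (n : ℕ) : ∃ v, (n : ℝ) ≤ ‖v‖ ∧ φ v ≤ sSup A + 1 ∧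
      (1 + ‖v‖) * ‖φ' v‖ ≤ 10 * (1 / ((n : ℝ) + 1)) := by
    set ε : ℝ := 1 / ((n : ℝ) + 1) with hε_def
    have hε : 0 < ε := by positivity
    have hε1 : ε ≤ 1 := by
      rw [hε_def, div_le_one (by positivity)]
      linarith [(Nat.cast_nonneg n : (0 : ℝ) ≤ n)]
    obtain ⟨a, ⟨r, hr⟩, ha⟩ := exists_lt_of_lt_csSup hA_ne (sub_lt_self (sSup A) hε)
    have hnot : sSup A + ε ∉ A := fun h => by linarith [le_csSup hA_bdd h]
    simp only [A, Set.mem_ofPred_eq, not_exists, not_forall, not_le] at hnot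
    obtain ⟨x, hx, hφx⟩ := hnot (max (2 * r + 1) (2 * n + 1))
    obtain ⟨hxr, hxn⟩ := max_le_iff.1 hx
    have hn : (0 : ℝ) ≤ n := n.cast_nonneg
    have hx0 : 0 < ‖x‖ := by linarith
    obtain ⟨v, hvx, hφv, hφ'v⟩ := exists_norm_fderiv_le_of_le_add hderiv hr
      (mul_pos two_pos hε) hx0 (by linarith) (by linarith)
    have h₁ := norm_sub_norm_le x v
    have h₂ := norm_sub_norm_le v x
    rw [norm_sub_rev] at h₁
    refine ⟨v, by linarith, by linarith, ?_⟩
    calc (1 + ‖v‖) * ‖φ' v‖ ≤ (5 / 2 * ‖x‖) * (2 * (2 * ε) / ‖x‖) := by gcongr; linarith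
      _ = 10 * ε := by field_simp; norm_num
  choose u hnorm hφu hφ'u using key
  obtain ⟨w, σ, hσ, hw⟩ := hCerami u
    ⟨max |b| |sSup A + 1|, fun n => abs_le_max_abs_abs (hb _) (hφu n)⟩
    (squeeze_zero (fun n => by positivity) hφ'u
      (by simpa using tendsto_one_div_add_atTop_nhds_zero_nat.const_mul (10 : ℝ)))
  refine not_tendsto_nhds_of_tendsto_atTop ?_ ‖w‖ hw.norm
  exact (Filter.tendsto_atTop_mono hnorm tendsto_natCast_atTop_atTop).comp hσ.tendsto_atTop
end
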